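/- arXiv:1108.5641 — 2 statements merged into one kernel-verified Lean document; each statement's English description precedes it below -/
import Mathlib

section
/- Let F be a free group of finite rank and A a nonabelian subgroup of F. Then acl(A) is compressed: for every finitely generated subgroup K with acl(A) ≤ K ≤ F, one has rk(acl(A)) ≤ rk(K). -/
open FirstOrder Filter

/-! Common definitions: the first-order language of groups, algebraic/definable closures,
free products, amalgams, HNN extensions, etc. -/

/-- Function symbols of the language of groups: `1`, `⁻¹`, `·`. -/
inductive GrpFunc : ℕ → Type
  | one : GrpFunc 0
  | inv : GrpFunc 1
  | mul : GrpFunc 2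

/-- The first-order language of groups `L = {·, ⁻¹, 1}` (no relation symbols). -/
def grpLang : FirstOrder.Language := ⟨GrpFunc, fun _ => Empty⟩

/-- Every group is a `grpLang`-structure in the natural way. -/
instance grpStructure (G : Type*) [Group G] : grpLang.Structure G where
  funMap {_} f := match f with
    | .one => fun _ => (1 : G)
    | .inv => fun x => (x 0)⁻¹
    | .mul => fun x => x 0 * x 1
  RelMap {_} r := Empty.elim r

/-- A formula is existential if it is obtained from a quantifier-free formula by
prefixing existential quantifiers. -/
def IsExistential {L : FirstOrder.Language} {α : Type*} (φ : L.Formula α) : Prop :=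
  ∃ (n : ℕ) (ψ : L.BoundedFormula α n), ψ.IsQF ∧ φ = ψ.exs

section ModelTheory

variable (L : FirstOrder.Language) {M : Type*} [L.Structure M]

/-- The algebraic closure of a set of parameters `A` in an `L`-structure `M`:
elements satisfying, together with only finitely many other elements, some formula
with parameters from `A`. -/
def Lacl (A : Set M) : Set M :=
  {b | ∃ φ : L.Formula (↥A ⊕ Fin 1),
    {c : M | φ.Realize (Sum.elim Subtype.val fun _ => c)}.Finite ∧
    φ.Realize (Sum.elim Subtype.val fun _ => b)}

/-- The definable closure of a set of parameters `A` in an `L`-structure `M`. -/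
def Ldcl (A : Set M) : Set M :=
  {b | ∃ φ : L.Formula (↥A ⊕ Fin 1),
    {c : M | φ.Realize (Sum.elim Subtype.val fun _ => c)} = {b}}

/-- The existential algebraic closure of `A` in `M`. -/
def LaclE (A : Set M) : Set M :=
  {b | ∃ φ : L.Formula (↥A ⊕ Fin 1), IsExistential φ ∧
    {c : M | φ.Realize (Sum.elim Subtype.val fun _ => c)}.Finite ∧
    φ.Realize (Sum.elim Subtype.val fun _ => b)}

/-- The existential definable closure of `A` in `M`. -/
def LdclE (A : Set M) : Set M :=
  {b | ∃ φ : L.Formula (↥A ⊕ Fin 1), IsExistential φ ∧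
    {c : M | φ.Realize (Sum.elim Subtype.val fun _ => c)} = {b}}

end ModelTheory

section GroupDefs

variable {G : Type*} [Group G]

/-- Algebraic closure in a group, w.r.t. the language of groups. -/
def acl (A : Set G) : Set G := Lacl grpLang A

/-- Definable closure in a group, w.r.t. the language of groups. -/
def dcl (A : Set G) : Set G := Ldcl grpLang A

/-- Existential algebraic closure in a group. -/
def aclE (A : Set G) : Set G := LaclE grpLang A

/-- Existential definable closure in a group. -/
def dclE (A : Set G) : Set G := LdclE grpLang A

/-- Restricted algebraic closure: elements with finite orbit under automorphisms
of `G` fixing `A` pointwise. -/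
def racl (A : Set G) : Set G :=
  {g | {x : G | ∃ f : G ≃* G, (∀ a ∈ A, f a = a) ∧ f g = x}.Finite}

/-- Restricted definable closure: elements fixed by every automorphism of `G`
fixing `A` pointwise. -/
def rdcl (A : Set G) : Set G :=
  {g | ∀ f : G ≃* G, (∀ a ∈ A, f a = a) → f g = g}

/-- A set of group elements is nonabelian (contains two non-commuting elements). -/
def Nonabelian (A : Set G) : Prop := ∃ x ∈ A, ∃ y ∈ A, x * y ≠ y * x

/-- `F` is a free group of finite rank. -/
def IsFreeOfFiniteRank (F : Type*) [Group F] : Prop :=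
  ∃ n : ℕ, Nonempty (F ≃* FreeGroup (Fin n))

/-- `G` is the internal free product of its subgroups `H` and `K`: the canonical
homomorphism from the abstract free product `H ∗ K` to `G` is an isomorphism. -/
def InternalFreeProduct (H K : Subgroup G) : Prop :=
  Function.Bijective (Monoid.Coprod.lift H.subtype K.subtype)

/-- `G` is freely indecomposable relative to its subgroup `A`. -/
def FreelyIndecomposableRel (A : Subgroup G) : Prop :=
  ¬ ∃ G₁ G₂ : Subgroup G, G₁ ≠ ⊥ ∧ G₂ ≠ ⊥ ∧ A ≤ G₁ ∧ InternalFreeProduct G₁ G₂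

/-- `B` is a free factor of the subgroup `K`: there is `L` such that the canonical
homomorphism from the abstract free product `B ∗ L` to the ambient group is injective
with image exactly `K`. -/
def IsFreeFactorOf (B K : Subgroup G) : Prop :=
  ∃ L : Subgroup G,
    Function.Injective (Monoid.Coprod.lift B.subtype L.subtype) ∧
    (Monoid.Coprod.lift B.subtype L.subtype).range = K

/-- `K'` is the amalgamated free product `K ∗_C B` inside the ambient group `G`:
the canonical homomorphism from the abstract amalgamated product (pushout) of `K` and
`B` over `C` to `G` is injective with image exactly `K'`. -/
def IsAmalgamOf (K B C : Subgroup G) (hCK : C ≤ K) (hCB : C ≤ B) (K' : Subgroup G) : Prop :=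
  ∃ ℓ : Monoid.PushoutI
      (fun i : Bool =>
        (Subgroup.inclusion (show C ≤ cond i K B by cases i <;> assumption) :
          ↥C →* ↥(cond i K B))) →* G,
    (∀ i : Bool, ℓ.comp (Monoid.PushoutI.of i) = (cond i K B).subtype) ∧
    Function.Injective ℓ ∧ ℓ.range = K'

/-- `K'` is the HNN extension of `K` along `φ : C ≃* D` inside the ambient group `G`:
the canonical homomorphism from the abstract HNN extension of `K` along `φ` to `G` is
injective with image exactly `K'` (and is the inclusion on `K`). -/
def IsHNNOf (K : Subgroup G) {C D : Subgroup ↥K} (φ : ↥C ≃* ↥D) (K' : Subgroup G) : Prop :=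
  ∃ ℓ : HNNExtension ↥K C D φ →* G,
    ℓ.comp HNNExtension.of = K.subtype ∧ Function.Injective ℓ ∧ ℓ.range = K'

/-- One constructibility step: `K'` is an amalgamated free product of `K` with some
subgroup over a cyclic subgroup, or an HNN extension of `K` along an isomorphism of two
cyclic subgroups of `K`. -/
def ConstructStep (K K' : Subgroup G) : Prop :=
  (∃ (B C : Subgroup G) (hCK : C ≤ K) (hCB : C ≤ B),
      (∃ c : G, C = Subgroup.zpowers c) ∧ B ≤ K' ∧ K ≤ K' ∧ IsAmalgamOf K B C hCK hCB K')
  ∨ (∃ (C D : Subgroup ↥K) (φ : ↥C ≃* ↥D),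
      (∃ c : ↥K, C = Subgroup.zpowers c) ∧ (∃ d : ↥K, D = Subgroup.zpowers d) ∧ IsHNNOf K φ K')

/-- `B` is constructible from `A` by a finite sequence of amalgamated free products and
HNN-extensions along cyclic subgroups. -/
def ConstructibleFrom (A B : Subgroup G) : Prop := Relation.ReflTransGen ConstructStep A B

/-- The rank of a subgroup: the least cardinality of a generating set. For (subgroups of)
free groups this is the cardinality of a basis. -/
noncomputable def srank (H : Subgroup G) : Cardinal :=
  sInf {c : Cardinal | ∃ S : Set G, Subgroup.closure S = H ∧ c = Cardinal.mk ↥S}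

/-- `M` is a maximal abelian subgroup. -/
def IsMaxAbelian (M : Subgroup G) : Prop :=
  (∀ x ∈ M, ∀ y ∈ M, x * y = y * x) ∧
  ∀ N : Subgroup G, (∀ x ∈ N, ∀ y ∈ N, x * y = y * x) → M ≤ N → M = N

/-- `M` is a maximal abelian subgroup of the subgroup `H`. -/
def IsMaxAbelianIn (M H : Subgroup G) : Prop :=
  M ≤ H ∧ (∀ x ∈ M, ∀ y ∈ M, x * y = y * x) ∧
  ∀ N : Subgroup G, N ≤ H → (∀ x ∈ N, ∀ y ∈ N, x * y = y * x) → M ≤ N → M = N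

/-- `M` is a malnormal subgroup: `gMg⁻¹ ∩ M = 1` for every `g ∉ M`. -/
def Malnormal (M : Subgroup G) : Prop :=
  ∀ g : G, g ∉ M → ∀ x ∈ M, g * x * g⁻¹ ∈ M → x = 1

/-- A group is CSA if every maximal abelian subgroup is malnormal. -/
def IsCSA (G : Type*) [Group G] : Prop := ∀ M : Subgroup G, IsMaxAbelian M → Malnormal M

/-- Every abelian subgroup of `G` is cyclic. -/
def AbelianSubgroupsCyclic (G : Type*) [Group G] : Prop :=
  ∀ H : Subgroup G, (∀ x ∈ H, ∀ y ∈ H, x * y = y * x) → ∃ g : G, H = Subgroup.zpowers g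

/-- `G` is equationally noetherian: every system of equations over `G` in finitely many
variables is equivalent to a finite subsystem. -/
def EqNoetherian (G : Type*) [Group G] : Prop :=
  ∀ n : ℕ, 0 < n → ∀ S : Set (Monoid.Coprod G (FreeGroup (Fin n))),
    ∃ S₀ : Set (Monoid.Coprod G (FreeGroup (Fin n))), S₀ ⊆ S ∧ S₀.Finite ∧
      ∀ f : Monoid.Coprod G (FreeGroup (Fin n)) →* G,
        f.comp Monoid.Coprod.inl = MonoidHom.id G →
        ((∀ s ∈ S₀, f s = 1) ↔ ∀ s ∈ S, f s = 1)

/-- A group homomorphism is elementary w.r.t. the language of groups: it preserves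
and reflects all first-order formulas. -/
def ElementaryEmb {H K : Type*} [Group H] [Group K] (e : H →* K) : Prop :=
  ∀ (n : ℕ) (φ : grpLang.Formula (Fin n)) (v : Fin n → H),
    (φ.Realize fun i => e (v i)) ↔ φ.Realize v

/-- The inclusion of the subgroup `H` is an elementary embedding; i.e. the ambient group
is an elementary extension of `H`. -/
def ElementarySub (H : Subgroup G) : Prop := ElementaryEmb H.subtype

/-- A sequence of homomorphisms is stable. -/
def StableSeq {K H : Type*} [Group K] [Group H] (h : ℕ → (K →* H)) : Prop :=
  ∀ k : K, (∀ᶠ n in Filter.atTop, h n k = 1) ∨ (∀ᶠ n in Filter.atTop, h n k ≠ 1)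

/-- A sequence of homomorphisms has trivial stable kernel. -/
def TrivialStableKernel {K H : Type*} [Group K] [Group H] (h : ℕ → (K →* H)) : Prop :=
  ∀ k : K, (∀ᶠ n in Filter.atTop, h n k = 1) → k = 1

/-- A stable sequence of homomorphisms `g n : D → H` with trivial stable kernel strongly
converges to `D`, where `D` is a subgroup of an extension of the base group `H`, the base
group being embedded via `e`. -/
def StronglyConverges {H Gs : Type*} [Group H] [Group Gs] (e : H →* Gs)
    (D : Subgroup Gs) (g : ℕ → (↥D →* H)) : Prop :=
  StableSeq g ∧ TrivialStableKernel g ∧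
  (∀ (d : ↥D) (b : H), (d : Gs) = e b → ∀ᶠ n in Filter.atTop, g n d = b) ∧
  (∀ (d : ↥D) (b : H), (∃ᶠ n in Filter.atTop, g n d = b) → (d : Gs) = e b)

/-- The ball of radius `r` about the identity in the word metric w.r.t. `S`. -/
def wordBall (S : Set G) (r : ℕ) : Set G :=
  {g | ∃ l : List G, l.length ≤ r ∧ (∀ x ∈ l, x ∈ S ∨ x⁻¹ ∈ S) ∧ l.prod = g}

end GroupDefs

namespace FreeGroup
variable {α : Type*} [DecidableEq α]

theorem exists_common_prefix {β : Type*} (a b : List β) :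
    ∃ p s t : List β, a = p ++ s ∧ b = p ++ t ∧
      ∀ x ∈ s.head?, ∀ y ∈ t.head?, x ≠ y := by
  classical
  induction a generalizing b with
  | nil => exact ⟨[], [], b, by simp, by simp, by simp⟩
  | cons x a ih =>
    cases b with
    | nil => exact ⟨[], x :: a, [], by simp, by simp, by simp⟩
    | cons y b =>
      by_cases h : x = y
      · obtain ⟨p, s, t, rfl, rfl, hst⟩ := ih b
        exact ⟨x :: p, s, t, by simp, by simp [h], hst⟩
      · exact ⟨[], x :: a, y :: b, by simp, by simp, by simpa using h⟩

theorem isReduced_invRev_append {s t : List (α × Bool)} (hs : IsReduced s) (ht : IsReduced t)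
    (h : ∀ x ∈ s.head?, ∀ y ∈ t.head?, x ≠ y) : IsReduced (invRev s ++ t) := by
  have hs' : IsReduced (invRev s) := by
    rw [isReduced_iff_reduce_eq] at hs ⊢
    rw [reduce_invRev, hs]
  refine List.isChain_append.2 ⟨hs', ht, ?_⟩
  intro x hx y hy hxy
  cases s with
  | nil => simp [invRev] at hx
  | cons z s =>
    have := h z (by simp) y hy
    simp [invRev] at hx
    subst hx
    simp at hxy
    have h1 : z.2 ≠ y.2 := fun h2 => this (Prod.ext hxy h2)
    revert h1
    cases z.2 <;> cases y.2 <;> simp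

/-- The words of two elements split along their longest common prefix. -/
theorem exists_split (a b : FreeGroup α) : ∃ p s t : List (α × Bool),
    a.toWord = p ++ s ∧ b.toWord = p ++ t ∧ norm (a⁻¹ * b) = s.length + t.length ∧
    (∀ x ∈ s.head?, ∀ y ∈ t.head?, x ≠ y) := by
  obtain ⟨p, s, t, ha, hb, h⟩ := exists_common_prefix a.toWord b.toWord
  refine ⟨p, s, t, ha, hb, ?_, h⟩
  have hs : IsReduced s := (ha ▸ isReduced_toWord (x := a)).infix ⟨p, [], by simp⟩
  have ht : IsReduced t := (hb ▸ isReduced_toWord (x := b)).infix ⟨p, [], by simp⟩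
  have : a⁻¹ * b = mk (invRev s ++ t) := by
    rw [← mk_toWord (x := a), ← mk_toWord (x := b), ha, hb, ← mul_mk, ← mul_mk, ← mul_mk, ← inv_mk]
    group
  rw [this, norm, toWord_mk, (isReduced_invRev_append hs ht h).reduce_eq]
  simp

theorem norm_inv_mul_comm (a b : FreeGroup α) : norm (a⁻¹ * b) = norm (b⁻¹ * a) := by
  rw [← norm_inv_eq]; simp

theorem norm_triangle (a b c : FreeGroup α) :
    norm (a⁻¹ * c) ≤ norm (a⁻¹ * b) + norm (b⁻¹ * c) := by
  have := norm_mul_le (a⁻¹ * b) (b⁻¹ * c)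
  simpa [mul_assoc] using this

/-- Word norms satisfy Gromov's `0`-hyperbolic inequality at the identity. -/
theorem norm_hyperbolic_one (a b c : FreeGroup α) :
    norm b + norm (a⁻¹ * c) ≤ max (norm c + norm (a⁻¹ * b)) (norm a + norm (b⁻¹ * c)) := by
  obtain ⟨p, s, t, ha, hb, h, -⟩ := exists_split a b
  obtain ⟨q, s', t', hb', hc, h', -⟩ := exists_split b c
  obtain ⟨r, s'', t'', ha'', hc'', h'', hne⟩ := exists_split a c
  have key : min p.length q.length ≤ r.length := by
    by_contra! hlt
    rw [lt_min_iff] at hlt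
    have e1 : a.toWord[r.length]? = b.toWord[r.length]? := by
      rw [ha, hb, List.getElem?_append_left hlt.1, List.getElem?_append_left hlt.1]
    have e2 : b.toWord[r.length]? = c.toWord[r.length]? := by
      rw [hb', hc, List.getElem?_append_left hlt.2, List.getElem?_append_left hlt.2]
    have e3 := e1.trans e2
    have l1 : s''.length ≠ 0 := by
      have := congrArg List.length (ha.symm.trans ha'')
      simp at this; omega
    have l2 : t''.length ≠ 0 := by
      have := congrArg List.length (hc.symm.trans hc'')
      simp at this; omega
    rw [ha'', hc''] at e3
    cases s'' with
    | nil => simp at l1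
    | cons x s'' =>
      cases t'' with
      | nil => simp at l2
      | cons y t'' =>
        simp at e3 hne
        exact hne e3
  have hna : norm a = p.length + s.length := by rw [norm, ha, List.length_append]
  have hna' : norm a = r.length + s''.length := by rw [norm, ha'', List.length_append]
  have hnb : norm b = p.length + t.length := by rw [norm, hb, List.length_append]
  have hnb' : norm b = q.length + s'.length := by rw [norm, hb', List.length_append]
  have hnc : norm c = q.length + t'.length := by rw [norm, hc, List.length_append]
  have hnc' : norm c = r.length + t''.length := by rw [norm, hc'', List.length_append]
  omega

/-- The four-point condition for word norms. -/
theorem norm_hyperbolic (x a b c : FreeGroup α) :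
    norm (x⁻¹ * b) + norm (a⁻¹ * c) ≤
      max (norm (x⁻¹ * c) + norm (a⁻¹ * b)) (norm (x⁻¹ * a) + norm (b⁻¹ * c)) := by
  simpa [mul_assoc] using norm_hyperbolic_one (x⁻¹ * a) (x⁻¹ * b) (x⁻¹ * c)

theorem exists_mem_segment (y : FreeGroup α) {n : ℕ} (hn : n ≤ norm y) :
    ∃ p : FreeGroup α, norm p = n ∧ norm p + norm (p⁻¹ * y) = norm y := by
  have key : ∀ w : List (α × Bool), IsReduced w → norm (mk w) = w.length := fun w hw => by
    rw [norm, toWord_mk, hw.reduce_eq]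
  have hy := isReduced_toWord (x := y)
  have h1 := key _ (hy.infix (List.take_prefix n _).isInfix)
  have h2 := key _ (hy.infix (List.drop_suffix n _).isInfix)
  have h3 : (mk (y.toWord.take n))⁻¹ * y = mk (y.toWord.drop n) := by
    rw [inv_mul_eq_iff_eq_mul, mul_mk, List.take_append_drop, mk_toWord]
  refine ⟨mk (y.toWord.take n), ?_, ?_⟩
  · rw [h1, List.length_take]; exact min_eq_left hn
  · rw [h3, h1, h2, norm, ← List.length_append, List.take_append_drop]

/-- Any three elements of a free group have a median. -/
theorem exists_median (x y z : FreeGroup α) : ∃ m : FreeGroup α,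
    norm (x⁻¹ * m) + norm (m⁻¹ * y) = norm (x⁻¹ * y) ∧
    norm (y⁻¹ * m) + norm (m⁻¹ * z) = norm (y⁻¹ * z) ∧
    norm (x⁻¹ * m) + norm (m⁻¹ * z) = norm (x⁻¹ * z) := by
  have key : ∀ w : List (α × Bool), IsReduced w → norm (mk w) = w.length := fun w hw => by
    rw [norm, toWord_mk, hw.reduce_eq]
  obtain ⟨p, s, t, ha, hb, h, -⟩ := exists_split (x⁻¹ * y) (x⁻¹ * z)
  have hs := key s ((ha ▸ isReduced_toWord (x := x⁻¹ * y)).infix ⟨p, [], by simp⟩)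
  have hp := key p ((ha ▸ isReduced_toWord (x := x⁻¹ * y)).infix ⟨[], s, by simp⟩)
  have ht := key t ((hb ▸ isReduced_toWord (x := x⁻¹ * z)).infix ⟨p, [], by simp⟩)
  have e1 : x⁻¹ * y = mk p * mk s := by rw [← mk_toWord (x := x⁻¹ * y), ha, mul_mk]
  have e2 : x⁻¹ * z = mk p * mk t := by rw [← mk_toWord (x := x⁻¹ * z), hb, mul_mk]
  have hy : y = x * mk p * mk s := by rw [mul_assoc, ← e1]; group
  have hz : z = x * mk p * mk t := by rw [mul_assoc, ← e2]; group
  have ny : norm (x⁻¹ * y) = p.length + s.length := by rw [norm, ha, List.length_append]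
  have nz : norm (x⁻¹ * z) = p.length + t.length := by rw [norm, hb, List.length_append]
  have nyz : norm (y⁻¹ * z) = s.length + t.length := by rw [← h]; congr 1; group
  have m1 : norm (x⁻¹ * (x * mk p)) = p.length := by rw [← hp]; congr 1; group
  have m2 : norm ((x * mk p)⁻¹ * y) = s.length := by rw [← hs, hy]; congr 1; group
  have m3 : norm ((x * mk p)⁻¹ * z) = t.length := by rw [← ht, hz]; congr 1; group
  have m4 := norm_inv_mul_comm y (x * mk p)
  exact ⟨x * mk p, by omega, by omega, by omega⟩

/-- An element moving the far endpoint of `[1, y]` in almost the same direction, and moving `1` only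
a little, translates the middle of `[1, y]` along `[1, y]`. -/
theorem norm_translate {g y p : FreeGroup α} (hp : norm p + norm (p⁻¹ * y) = norm y)
    (hg : norm g < norm p)
    (hgy : norm (y⁻¹ * (g * y)) + 2 * (norm p + norm g) ≤ norm y + norm (g * y)) :
    norm (g * p) + norm ((g * p)⁻¹ * y) = norm y ∧
      norm (g * p) + norm y = norm p + norm (g * y) := by
  have h1 := norm_hyperbolic 1 g⁻¹ y p
  have h2 := norm_hyperbolic 1 g⁻¹ p y
  have h3 := norm_hyperbolic 1 p g⁻¹ y
  have h4 := norm_triangle 1 (g * p) y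
  have h5 := norm_hyperbolic 1 (g * p) (g * y) y
  have t1 := norm_mul_le g p
  have t2 := norm_mul_le g⁻¹ (g * p)
  have e1 : (g * p)⁻¹ * (g * y) = p⁻¹ * y := by group
  have e2 := norm_inv_mul_comm y p
  have e3 := norm_inv_mul_comm y (g * y)
  have e4 := norm_inv_mul_comm p g⁻¹
  have e5 := norm_inv_mul_comm (g * p) y
  have e6 := norm_inv_eq (x := g)
  have e7 := norm_inv_eq (x := p)
  have e8 := norm_inv_eq (x := p⁻¹ * g⁻¹)
  simp [mul_assoc] at *
  omega

/-- Two points of `[1, y]` at the same distance from `1` coincide. -/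
theorem eq_of_mem_segment {u v y : FreeGroup α} (hu : norm u + norm (u⁻¹ * y) = norm y)
    (hv : norm v + norm (v⁻¹ * y) = norm y) (h : norm u = norm v) : u = v := by
  have h1 := norm_hyperbolic 1 u y v
  have e := norm_inv_mul_comm y v
  have : norm (u⁻¹ * v) = 0 := by
    simp at h1; omega
  rwa [norm_eq_zero, inv_mul_eq_one] at this

/-- Elements of small norm nearly fixing a long segment commute. -/
theorem commute_of_norm_le {g h y : FreeGroup α} {R : ℕ} (hg : norm g ≤ R) (hh : norm h ≤ R)
    (hgy : norm (y⁻¹ * (g * y)) + 8 * R + 8 ≤ norm y + norm (g * y))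
    (hhy : norm (y⁻¹ * (h * y)) + 8 * R + 8 ≤ norm y + norm (h * y)) : g * h = h * g := by
  have t := norm_mul_le g y
  have ty := norm_triangle 1 (g * y) y
  have t3 := norm_inv_mul_comm (g * y) y
  obtain ⟨p, hpn, hp⟩ := exists_mem_segment y (n := 2 * R + 1) (by simp at *; omega)
  obtain ⟨a1, a2⟩ := norm_translate hp (g := g) (by omega) (by omega)
  obtain ⟨b1, b2⟩ := norm_translate hp (g := h) (by omega) (by omega)
  have n1 := norm_mul_le g p
  have n2 := norm_mul_le h p
  have n3 := norm_mul_le g⁻¹ (g * p)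
  have n4 := norm_mul_le h⁻¹ (h * p)
  simp at n3 n4
  obtain ⟨c1, c2⟩ := norm_translate a1 (g := h) (by omega) (by omega)
  obtain ⟨d1, d2⟩ := norm_translate b1 (g := g) (by omega) (by omega)
  have := eq_of_mem_segment c1 d1 (by omega)
  rw [← mul_assoc, ← mul_assoc] at this
  exact (mul_right_cancel this).symm

end FreeGroup

section PartialSchreier

open Finset

variable {ι : Type*} [Fintype ι] {Ω : Type*} [DecidableEq Ω] [MulAction (FreeGroup ι) Ω]

/-- The edges of the Schreier graph of an action of a free group with both endpoints in `P`. -/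
def schreierEdges (P : Finset Ω) : Finset (ι × Ω) :=
  (univ ×ˢ P).filter fun e => FreeGroup.of e.1 • e.2 ∈ P

theorem mem_schreierEdges {P : Finset Ω} {e : ι × Ω} :
    e ∈ schreierEdges P ↔ e.2 ∈ P ∧ FreeGroup.of e.1 • e.2 ∈ P := by
  simp [schreierEdges]

/-- A tree `C` with edges `D` rooted at `p₀` in the partial Schreier graph on `P`; the element
`τ p` is read along the path from `p₀` to `p`. -/
structure IsSchreierTree (P : Finset Ω) (p₀ : Ω) (C : Finset Ω) (D : Finset (ι × Ω))
    (τ : Ω → FreeGroup ι) : Prop where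
  subset : C ⊆ P
  root_mem : p₀ ∈ C
  edge_mem : D ⊆ schreierEdges C
  card : #C = #D + 1
  sum_le : ∀ f : Ω → ℕ,
    ∑ e ∈ D, min (f e.2) (f (FreeGroup.of e.1 • e.2)) + f p₀ ≤ ∑ p ∈ C, f p
  root : τ p₀ = 1
  smul_root : ∀ p ∈ C, τ p • p₀ = p
  edge : ∀ e ∈ D, τ (FreeGroup.of e.1 • e.2) = FreeGroup.of e.1 * τ e.2
  ind : ∀ Q : Ω → Prop, Q p₀ → (∀ e ∈ D, Q e.2 ↔ Q (FreeGroup.of e.1 • e.2)) → ∀ p ∈ C, Q p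

theorem IsSchreierTree.extend {P : Finset Ω} {p₀ : Ω} {C : Finset Ω} {D : Finset (ι × Ω)}
    {τ : Ω → FreeGroup ι} (h : IsSchreierTree P p₀ C D τ) {e : ι × Ω}
    (he : e ∈ schreierEdges P) {q r : Ω} (hq : q ∈ C) (hr : r ∉ C) (g : FreeGroup ι)
    (hqr : g • q = r) (hcase : (e.2 = q ∧ FreeGroup.of e.1 = g) ∨
      (e.2 = r ∧ FreeGroup.of e.1 = g⁻¹)) :
    ∃ (C' : Finset Ω) (D' : Finset (ι × Ω)) (τ' : Ω → FreeGroup ι),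
      IsSchreierTree P p₀ C' D' τ' ∧ #C < #C' := by
  classical
  have hne : ∀ p ∈ C, p ≠ r := fun p hp hpr => hr (hpr ▸ hp)
  have hends : e.2 ∈ insert r C ∧ FreeGroup.of e.1 • e.2 ∈ insert r C := by
    rcases hcase with ⟨h1, h2⟩ | ⟨h1, h2⟩
    · rw [h1, h2, hqr]; simp [hq]
    · rw [h1, h2, ← hqr, inv_smul_smul]; simp [hq]
  have hrP : r ∈ P := by
    have := mem_schreierEdges.1 he
    rcases hcase with ⟨h1, h2⟩ | ⟨h1, h2⟩
    · rw [h1, h2, hqr] at this; exact this.2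
    · rw [h1] at this; exact this.1
  have heD : e ∉ D := fun hD => by
    have := mem_schreierEdges.1 (h.edge_mem hD)
    rcases hcase with ⟨h1, h2⟩ | ⟨h1, h2⟩
    · rw [h1, h2, hqr] at this; exact hr this.2
    · rw [h1] at this; exact hr this.1
  refine ⟨insert r C, insert e D, Function.update τ r (g * τ q), ⟨?_, ?_, ?_, ?_, ?_, ?_, ?_, ?_, ?_⟩, ?_⟩
  · exact insert_subset hrP h.subset
  · exact mem_insert_of_mem h.root_mem
  · refine insert_subset (mem_schreierEdges.2 hends) fun d hd => ?_
    have := mem_schreierEdges.1 (h.edge_mem hd)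
    exact mem_schreierEdges.2 ⟨mem_insert_of_mem this.1, mem_insert_of_mem this.2⟩
  · rw [card_insert_of_notMem hr, card_insert_of_notMem heD, h.card]
  · intro f
    rw [sum_insert hr, sum_insert heD]
    have h1 := h.sum_le f
    have h2 : min (f e.2) (f (FreeGroup.of e.1 • e.2)) ≤ f r := by
      rcases hcase with ⟨h1, h2⟩ | ⟨h1, h2⟩
      · rw [h1, h2, hqr]; exact min_le_right _ _
      · rw [h1]; exact min_le_left _ _
    omega
  · rw [Function.update_of_ne (hne _ h.root_mem), h.root]
  · intro p hp
    by_cases hpr : p = r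
    · subst hpr
      rw [Function.update_self, mul_smul, h.smul_root q hq, hqr]
    · rw [Function.update_of_ne hpr]
      exact h.smul_root p ((mem_insert.1 hp).resolve_left hpr)
  · intro d hd
    rcases mem_insert.1 hd with rfl | hd
    · rcases hcase with ⟨h1, h2⟩ | ⟨h1, h2⟩
      · rw [h1, h2, hqr, Function.update_self, Function.update_of_ne (hne _ hq)]
      · rw [h1, h2, ← hqr, inv_smul_smul, hqr, Function.update_self,
          Function.update_of_ne (hne _ hq), inv_mul_cancel_left]
    · have := mem_schreierEdges.1 (h.edge_mem hd)
      rw [Function.update_of_ne (hne _ this.1), Function.update_of_ne (hne _ this.2), h.edge d hd]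
  · intro Q h0 hQ
    have hQC := h.ind Q h0 fun d hd => hQ d (mem_insert_of_mem hd)
    intro p hp
    rcases mem_insert.1 hp with rfl | hp
    · have h3 := hQ e (mem_insert_self _ _)
      rcases hcase with ⟨h1, h2⟩ | ⟨h1, h2⟩
      · rw [h1, h2, hqr] at h3; exact h3.1 (hQC q hq)
      · rw [h1, h2, ← hqr, inv_smul_smul, hqr] at h3; exact h3.2 (hQC q hq)
    · exact hQC p hp
  · rw [card_insert_of_notMem hr]; omega

/-- A maximal tree spans a connected component. -/
theorem exists_isSchreierTree (P : Finset Ω) {p₀ : Ω} (hp₀ : p₀ ∈ P) :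
    ∃ (C : Finset Ω) (D : Finset (ι × Ω)) (τ : Ω → FreeGroup ι), IsSchreierTree P p₀ C D τ ∧
      ∀ e ∈ schreierEdges (ι := ι) P, e.2 ∈ C ↔ FreeGroup.of e.1 • e.2 ∈ C := by
  classical
  let Q : ℕ → Prop := fun n => ∃ (C : Finset Ω) (D : Finset (ι × Ω)) (τ : Ω → FreeGroup ι),
    IsSchreierTree P p₀ C D τ ∧ #C = n
  have hQ1 : Q 1 := ⟨{p₀}, ∅, fun _ => 1,
    ⟨by simpa using hp₀, by simp, by simp, by simp, by simp, rfl, by simp, by simp, by simp⟩, by simp⟩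
  have hb : 1 ≤ #P := card_pos.2 ⟨p₀, hp₀⟩
  obtain ⟨C, D, τ, h, hC⟩ := Nat.findGreatest_spec hb hQ1
  have hmax : ∀ C' D' τ', IsSchreierTree P p₀ C' D' τ' → ¬ #C < #C' := fun C' D' τ' h' hlt => by
    have := Nat.le_findGreatest (P := Q) (card_le_card h'.subset) ⟨C', D', τ', h', rfl⟩
    omega
  refine ⟨C, D, τ, h, fun e he => ⟨fun h1 => ?_, fun h1 => ?_⟩⟩
  · by_contra h2
    obtain ⟨C', D', τ', h', hlt⟩ := h.extend he h1 h2 (FreeGroup.of e.1) rfl (Or.inl ⟨rfl, rfl⟩)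
    exact hmax _ _ _ h' hlt
  · by_contra h2
    obtain ⟨C', D', τ', h', hlt⟩ := h.extend he h1 h2 (FreeGroup.of e.1)⁻¹ (inv_smul_smul _ _)
      (Or.inr ⟨rfl, by simp⟩)
    exact hmax _ _ _ h' hlt

theorem card_schreierEdges_eq_add {P C : Finset Ω} (hCP : C ⊆ P)
    (hC : ∀ e ∈ schreierEdges (ι := ι) P, e.2 ∈ C ↔ FreeGroup.of e.1 • e.2 ∈ C) :
    #(schreierEdges (ι := ι) P) = #(schreierEdges (ι := ι) C) + #(schreierEdges (ι := ι) (P \ C)) := by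
  classical
  rw [← card_filter_add_card_filter_not (fun e : ι × Ω => e.2 ∈ C)]
  congr 2
  · ext e
    simp only [mem_filter, mem_schreierEdges]
    constructor
    · rintro ⟨h1, h2⟩
      exact ⟨h2, (hC e (mem_schreierEdges.2 h1)).1 h2⟩
    · rintro ⟨h1, h2⟩
      exact ⟨⟨hCP h1, hCP h2⟩, h1⟩
  · ext e
    simp only [mem_filter, mem_schreierEdges, Finset.mem_sdiff]
    constructor
    · rintro ⟨h1, h2⟩
      exact ⟨⟨h1.1, h2⟩, h1.2, fun h3 => h2 ((hC e (mem_schreierEdges.2 h1)).2 h3)⟩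
    · rintro ⟨h1, h2⟩
      exact ⟨⟨h1.1, h2.1⟩, h1.2⟩

/-- The stabilizer elements read along the edges outside of a spanning tree. -/
theorem IsSchreierTree.exists_generators {P : Finset Ω} {p₀ : Ω} {C : Finset Ω}
    {D : Finset (ι × Ω)} {τ : Ω → FreeGroup ι} (h : IsSchreierTree P p₀ C D τ)
    (hC : ∀ e ∈ schreierEdges (ι := ι) P, e.2 ∈ C ↔ FreeGroup.of e.1 • e.2 ∈ C) :
    ∃ T : Finset (FreeGroup ι), #T + #C ≤ #(schreierEdges (ι := ι) C) + 1 ∧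
      (∀ g ∈ T, g • p₀ = p₀) ∧
      ∀ w : List (ι × Bool), (∀ v, v <:+ w → FreeGroup.mk v • p₀ ∈ P) →
        FreeGroup.mk w • p₀ ∈ C ∧
        (τ (FreeGroup.mk w • p₀))⁻¹ * FreeGroup.mk w ∈ Subgroup.closure (T : Set (FreeGroup ι)) := by
  classical
  let γ : ι × Ω → FreeGroup ι := fun e =>
    (τ (FreeGroup.of e.1 • e.2))⁻¹ * FreeGroup.of e.1 * τ e.2
  have hγ : ∀ e ∈ schreierEdges (ι := ι) C,
      γ e ∈ Subgroup.closure (((schreierEdges C \ D).image γ : Finset _) : Set (FreeGroup ι)) := by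
    intro e he
    by_cases heD : e ∈ D
    · have : γ e = 1 := by simp only [γ]; rw [h.edge e heD]; group
      rw [this]; exact one_mem _
    · exact Subgroup.subset_closure (mem_coe.2 (mem_image_of_mem _ (Finset.mem_sdiff.2 ⟨he, heD⟩)))
  refine ⟨(schreierEdges C \ D).image γ, ?_, ?_, ?_⟩
  · have h1 := card_image_le (s := schreierEdges C \ D) (f := γ)
    rw [card_sdiff_of_subset h.edge_mem] at h1
    have h2 := card_le_card h.edge_mem
    have h3 := h.card
    omega
  · intro g hg
    obtain ⟨e, he, rfl⟩ := mem_image.1 hg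
    have he' := mem_schreierEdges.1 (Finset.mem_sdiff.1 he).1
    simp only [γ, mul_smul]
    rw [h.smul_root _ he'.1, inv_smul_eq_iff, h.smul_root _ he'.2]
  · intro w
    induction w with
    | nil =>
      intro hw
      rw [← FreeGroup.one_eq_mk, one_smul, h.root]
      exact ⟨h.root_mem, by simp⟩
    | cons a w ih =>
      intro hw
      obtain ⟨i, b⟩ := a
      obtain ⟨h1, h2⟩ := ih fun v hv => hw v (hv.trans (List.suffix_cons _ _))
      have h3 := hw _ List.suffix_rfl
      have h4 : FreeGroup.mk w • p₀ ∈ P := h.subset h1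
      have hmk : FreeGroup.mk ((i, b) :: w) = FreeGroup.mk [(i, b)] * FreeGroup.mk w := by
        rw [FreeGroup.mul_mk]; rfl
      rw [hmk] at h3 ⊢
      generalize FreeGroup.mk w = x at *
      cases b with
      | true =>
        change (FreeGroup.of i * x) • p₀ ∈ P at h3
        change (FreeGroup.of i * x) • p₀ ∈ C ∧ (τ ((FreeGroup.of i * x) • p₀))⁻¹ *
          (FreeGroup.of i * x) ∈ _
        rw [mul_smul] at h3 ⊢
        have h5 := (hC (i, x • p₀) (mem_schreierEdges.2 ⟨h4, h3⟩)).1 h1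
        refine ⟨h5, ?_⟩
        have h6 := mul_mem (hγ (i, x • p₀) (mem_schreierEdges.2 ⟨h1, h5⟩)) h2
        simpa [γ, mul_assoc] using h6
      | false =>
        have hinv : FreeGroup.mk [(i, false)] = (FreeGroup.of i)⁻¹ := rfl
        rw [hinv] at h3 ⊢
        rw [mul_smul] at h3 ⊢
        have h5 := (hC (i, (FreeGroup.of i)⁻¹ • x • p₀)
          (mem_schreierEdges.2 ⟨h3, by simpa using h4⟩)).2 (by simpa using h1)
        refine ⟨h5, ?_⟩
        have h6 := mul_mem (inv_mem (hγ (i, (FreeGroup.of i)⁻¹ • x • p₀)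
          (mem_schreierEdges.2 ⟨h5, by simpa using h1⟩))) h2
        simpa [γ, mul_assoc] using h6

/-- The permutation action of a free group on `Ω × H` twisted by a labelling of the edges. -/
noncomputable def twistedAction {H : Type*} [Group H] (c : ι × Ω → H) :
    FreeGroup ι →* Equiv.Perm (Ω × H) :=
  FreeGroup.lift fun i =>
    { toFun := fun x => (FreeGroup.of i • x.1, c (i, x.1) * x.2)
      invFun := fun x => ((FreeGroup.of i)⁻¹ • x.1, (c (i, (FreeGroup.of i)⁻¹ • x.1))⁻¹ * x.2)
      left_inv := fun x => by simp
      right_inv := fun x => by simp }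

omit [Fintype ι] [DecidableEq Ω] in
theorem twistedAction_of {H : Type*} [Group H] (c : ι × Ω → H) (i : ι) (x : Ω × H) :
    twistedAction c (FreeGroup.of i) x = (FreeGroup.of i • x.1, c (i, x.1) * x.2) := by
  simp [twistedAction]

theorem IsSchreierTree.card_edges_le {P : Finset Ω} {p₀ : Ω} {C : Finset Ω}
    {D : Finset (ι × Ω)} {τ : Ω → FreeGroup ι} (h : IsSchreierTree P p₀ C D τ)
    (hcomm : ∀ g k : FreeGroup ι, g • p₀ = p₀ → k • p₀ = p₀ → g * k = k * g) :
    #(schreierEdges (ι := ι) C) ≤ #C := by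
  classical
  by_contra! hlt
  have hcard : 1 < #(schreierEdges C \ D) := by
    rw [card_sdiff_of_subset h.edge_mem]
    have := h.card
    omega
  obtain ⟨e, he, e', he', hee⟩ := one_lt_card.1 hcard
  let c : ι × Ω → Equiv.Perm (Fin 3) := fun d =>
    if d = e then Equiv.swap 0 1 else if d = e' then Equiv.swap 1 2 else 1
  have hcD : ∀ d ∈ D, c d = 1 := fun d hd => by
    have h1 : d ≠ e := fun h1 => (Finset.mem_sdiff.1 he).2 (h1 ▸ hd)
    have h2 : d ≠ e' := fun h2 => (Finset.mem_sdiff.1 he').2 (h2 ▸ hd)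
    simp [c, h1, h2]
  have hτ : ∀ p ∈ C, ∀ w, twistedAction c (τ p) (p₀, w) = (p, w) := by
    refine h.ind _ (fun w => by simp [h.root]) fun d hd => ?_
    rw [h.edge d hd]
    refine forall_congr' fun w => ?_
    rw [map_mul, Equiv.Perm.mul_apply]
    constructor
    · intro h1
      rw [h1, twistedAction_of, hcD d hd, one_mul]
    · intro h1
      rw [← (twistedAction c (FreeGroup.of d.1)).injective.eq_iff, h1, twistedAction_of, hcD d hd,
        one_mul]
  have hγ : ∀ d ∈ schreierEdges C, ∀ w, twistedAction c
      ((τ (FreeGroup.of d.1 • d.2))⁻¹ * FreeGroup.of d.1 * τ d.2) (p₀, w) = (p₀, c d * w) := by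
    intro d hd w
    have hd' := mem_schreierEdges.1 hd
    rw [map_mul, map_mul, map_inv, Equiv.Perm.mul_apply, Equiv.Perm.mul_apply, hτ _ hd'.1,
      Equiv.Perm.inv_eq_iff_eq, hτ _ hd'.2, twistedAction_of]
  have hst : ∀ d ∈ schreierEdges C,
      ((τ (FreeGroup.of d.1 • d.2))⁻¹ * FreeGroup.of d.1 * τ d.2) • p₀ = p₀ := by
    intro d hd
    have hd' := mem_schreierEdges.1 hd
    rw [mul_smul, mul_smul, h.smul_root _ hd'.1, inv_smul_eq_iff, h.smul_root _ hd'.2]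
  have h1 := (Finset.mem_sdiff.1 he).1
  have h2 := (Finset.mem_sdiff.1 he').1
  have h3 := congrArg (fun g => twistedAction c g (p₀, 1)) (hcomm _ _ (hst e h1) (hst e' h2))
  simp only [map_mul (twistedAction c) (_ * τ e.2), map_mul (twistedAction c) (_ * τ e'.2),
    Equiv.Perm.mul_apply] at h3
  rw [hγ e' h2, hγ e h1, hγ e h1, hγ e' h2] at h3
  have h4 := congrArg Prod.snd h3
  simp only [c, if_pos, if_neg hee.symm] at h4
  revert h4
  decide

/-- A partial Schreier graph of an action with abelian stabilizers has nonnegative Euler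
characteristic. -/
theorem card_schreierEdges_le (P : Finset Ω)
    (hcomm : ∀ p ∈ P, ∀ g k : FreeGroup ι, g • p = p → k • p = p → g * k = k * g) :
    #(schreierEdges (ι := ι) P) ≤ #P := by
  induction P using Finset.strongInduction with
  | H P ih =>
    obtain rfl | ⟨p₀, hp₀⟩ := P.eq_empty_or_nonempty
    · simp [schreierEdges]
    obtain ⟨C, D, τ, h, hC⟩ := exists_isSchreierTree (ι := ι) P hp₀
    have h1 := card_schreierEdges_eq_add h.subset hC
    have h2 := h.card_edges_le (hcomm p₀ hp₀)
    have h3 := ih (P \ C) (sdiff_ssubset h.subset ⟨p₀, h.root_mem⟩)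
      fun p hp => hcomm p (Finset.mem_sdiff.1 hp).1
    have h4 := card_sdiff_add_card_eq_card h.subset
    omega

variable {X : Type*} [DecidableEq X] [MulAction (FreeGroup ι) X]

/-- If `Q` lies over `P`, has fibres of size at least two and abelian stabilizers, then the Euler
characteristic of `Q` is at least twice that of `P`. -/
theorem two_mul_card_le_of_fibers (π : Ω → X) (hπ : ∀ (g : FreeGroup ι) ω, π (g • ω) = g • π ω)
    (P : Finset X) (Q : Finset Ω) (hQP : ∀ ω ∈ Q, π ω ∈ P)
    (hfib : ∀ p ∈ P, 2 ≤ #{ω ∈ Q | π ω = p})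
    (hcomm : ∀ p ∈ Q, ∀ g k : FreeGroup ι, g • p = p → k • p = p → g * k = k * g) :
    2 * #P + #(schreierEdges (ι := ι) Q) ≤ 2 * #(schreierEdges (ι := ι) P) + #Q := by
  classical
  induction P using Finset.strongInduction generalizing Q with
  | H P ih =>
    obtain rfl | ⟨p₀, hp₀⟩ := P.eq_empty_or_nonempty
    · have : Q = ∅ := eq_empty_of_forall_notMem fun ω hω => by simpa using hQP ω hω
      subst this
      simp [schreierEdges]
    obtain ⟨C, D, τ, h, hC⟩ := exists_isSchreierTree (ι := ι) P hp₀
    have h1 := card_schreierEdges_eq_add h.subset hC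
    have h4 := card_sdiff_add_card_eq_card h.subset
    set QC := Q.filter fun ω => π ω ∈ C with hQC
    have hsub : QC ⊆ Q := filter_subset _ _
    have h5 := card_sdiff_add_card_eq_card hsub
    have h6 := card_schreierEdges_eq_add (ι := ι) hsub fun e he => by
      have he' := mem_schreierEdges.1 he
      have := hC (e.1, π e.2) (mem_schreierEdges.2
        ⟨hQP _ he'.1, by rw [← hπ]; exact hQP _ he'.2⟩)
      simp only [hQC, mem_filter, he'.1, he'.2, true_and, hπ]
      exact this
    have h3 := ih (P \ C) (sdiff_ssubset h.subset ⟨p₀, h.root_mem⟩) (Q \ QC)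
      (fun ω hω => by
        rw [Finset.mem_sdiff] at hω ⊢
        exact ⟨hQP _ hω.1, fun h7 => hω.2 (mem_filter.2 ⟨hω.1, h7⟩)⟩)
      (fun p hp => by
        rw [Finset.mem_sdiff] at hp
        refine (hfib p hp.1).trans (card_le_card fun ω hω => ?_)
        rw [mem_filter] at hω ⊢
        refine ⟨Finset.mem_sdiff.2 ⟨hω.1, fun h7 => hp.2 ?_⟩, hω.2⟩
        rw [← hω.2]
        exact (mem_filter.1 h7).2)
      fun p hp => hcomm p (Finset.mem_sdiff.1 hp).1
    suffices 2 * #C + #(schreierEdges (ι := ι) QC) ≤ 2 * #(schreierEdges (ι := ι) C) + #QC by omega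
    by_cases hlt : #C ≤ #(schreierEdges (ι := ι) C)
    · have := card_schreierEdges_le (ι := ι) QC fun p hp => hcomm p (hsub hp)
      omega
    · have hDeq : D = schreierEdges C := eq_of_subset_of_card_le h.edge_mem (by
        have := h.card
        omega)
      let f : X → ℕ := fun p => #{ω ∈ Q | π ω = p}
      have hf := h.sum_le f
      have hQCf : #QC = ∑ p ∈ C, f p := by
        have hmap : Set.MapsTo π QC C := fun ω hω => (mem_filter.1 (mem_coe.1 hω)).2
        rw [card_eq_sum_card_fiberwise hmap]
        refine sum_congr rfl fun p hp => ?_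
        simp only [f, hQC, filter_filter]
        congr 1
        ext ω
        simp only [mem_filter]
        exact ⟨fun h => ⟨h.1, h.2.2⟩, fun h => ⟨h.1, by rw [h.2]; exact hp, h.2⟩⟩
      have hE : #(schreierEdges (ι := ι) QC) ≤
          ∑ e ∈ D, min (f e.2) (f (FreeGroup.of e.1 • e.2)) := by
        rw [card_eq_sum_card_fiberwise (f := fun e : ι × Ω => (e.1, π e.2)) (t := D)]
        · refine sum_le_sum fun e he => le_min ?_ ?_
          · refine card_le_card_of_injOn Prod.snd ?_ ?_
            · intro a ha
              simp only [mem_coe, mem_filter, mem_schreierEdges] at ha ⊢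
              exact ⟨hsub ha.1.1, by rw [← ha.2]⟩
            · intro a ha b hb hab
              simp only [coe_filter, Set.mem_ofPred_eq] at ha hb
              have h7 := ha.2.trans hb.2.symm
              exact Prod.ext (Prod.ext_iff.1 h7).1 hab
          · refine card_le_card_of_injOn (fun a => FreeGroup.of a.1 • a.2) ?_ ?_
            · intro a ha
              simp only [mem_coe, mem_filter, mem_schreierEdges] at ha ⊢
              refine ⟨hsub ha.1.2, ?_⟩
              rw [hπ, ← ha.2]
            · intro a ha b hb hab
              simp only [coe_filter, Set.mem_ofPred_eq] at ha hb
              have h7 : a.1 = b.1 := (Prod.ext_iff.1 (ha.2.trans hb.2.symm)).1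
              simp only [h7] at hab
              exact Prod.ext h7 (MulAction.injective _ hab)
        · intro e he
          have he' := mem_schreierEdges.1 he
          rw [hDeq]
          refine mem_schreierEdges.2 ⟨(mem_filter.1 he'.1).2, ?_⟩
          rw [← hπ]
          exact (mem_filter.1 he'.2).2
      have h8 : 2 ≤ f p₀ := hfib p₀ hp₀
      have h9 := h.card
      have h10 : #D = #(schreierEdges (ι := ι) C) := by rw [hDeq]
      omega

end PartialSchreier

section PartialSchreier

open Finset

variable {ι : Type*} [Fintype ι] {Ω : Type*} [DecidableEq Ω] [MulAction (FreeGroup ι) Ω]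
  {X : Type*} [DecidableEq X] [MulAction (FreeGroup ι) X]

/-- If the fibres of `Q` over `P` have size at least two away from the component of `x₀` and the
Euler characteristics of `P` and `Q` are balanced, then the stabilizer elements of `x₀` read inside
`P` lie in a subgroup of the stabilizer with few generators. -/
theorem exists_generators_of_fibers (π : Ω → X)
    (hπ : ∀ (g : FreeGroup ι) ω, π (g • ω) = g • π ω)
    (P : Finset X) (Q : Finset Ω) (hQP : ∀ ω ∈ Q, π ω ∈ P) {x₀ : X} (hx₀ : x₀ ∈ P)
    (hfib : ∀ p ∈ P, (∀ w : List (ι × Bool), (∀ v, v <:+ w → FreeGroup.mk v • x₀ ∈ P) →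
      FreeGroup.mk w • x₀ ≠ p) → 2 ≤ #{ω ∈ Q | π ω = p})
    (hcomm : ∀ p ∈ Q, ∀ g k : FreeGroup ι, g • p = p → k • p = p → g * k = k * g)
    (hchi : 2 + 2 * #(schreierEdges (ι := ι) P) + #Q ≤
      2 * #P + #(schreierEdges (ι := ι) Q) + 2 * Fintype.card ι) :
    ∃ T : Finset (FreeGroup ι), #T ≤ Fintype.card ι ∧ (∀ g ∈ T, g • x₀ = x₀) ∧
      ∀ w : List (ι × Bool), (∀ v, v <:+ w → FreeGroup.mk v • x₀ ∈ P) →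
        FreeGroup.mk w • x₀ = x₀ → FreeGroup.mk w ∈ Subgroup.closure (T : Set (FreeGroup ι)) := by
  obtain ⟨C, D, τ, h, hC⟩ := exists_isSchreierTree (ι := ι) P hx₀
  obtain ⟨T, hT, hTs, hTw⟩ := h.exists_generators hC
  refine ⟨T, ?_, hTs, fun w hw hwx => ?_⟩
  · have h1 := card_schreierEdges_eq_add h.subset hC
    have h4 := card_sdiff_add_card_eq_card h.subset
    set QC := Q.filter fun ω => π ω ∈ C with hQC
    have hsub : QC ⊆ Q := filter_subset _ _
    have h5 := card_sdiff_add_card_eq_card hsub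
    have h6 := card_schreierEdges_eq_add (ι := ι) hsub fun e he => by
      have he' := mem_schreierEdges.1 he
      have := hC (e.1, π e.2) (mem_schreierEdges.2
        ⟨hQP _ he'.1, by rw [← hπ]; exact hQP _ he'.2⟩)
      simp only [hQC, mem_filter, he'.1, he'.2, true_and, hπ]
      exact this
    have h3 := two_mul_card_le_of_fibers π hπ (P \ C) (Q \ QC)
      (fun ω hω => by
        rw [Finset.mem_sdiff] at hω ⊢
        exact ⟨hQP _ hω.1, fun h7 => hω.2 (mem_filter.2 ⟨hω.1, h7⟩)⟩)
      (fun p hp => by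
        rw [Finset.mem_sdiff] at hp
        refine (hfib p hp.1 fun w hw hwp => hp.2 (hwp ▸ (hTw w hw).1)).trans
          (card_le_card fun ω hω => ?_)
        rw [mem_filter] at hω ⊢
        refine ⟨Finset.mem_sdiff.2 ⟨hω.1, fun h7 => hp.2 ?_⟩, hω.2⟩
        rw [← hω.2]
        exact (mem_filter.1 h7).2)
      fun p hp => hcomm p (Finset.mem_sdiff.1 hp).1
    have := card_schreierEdges_le (ι := ι) QC fun p hp => hcomm p (hsub hp)
    omega
  · have := (hTw w hw).2
    rwa [hwx, h.root, inv_one, one_mul] at this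

end PartialSchreier

/-- `S x y z` says that `y` and `z` lie in the same direction from `x` in a median pretree. -/
structure IsDirTree {X : Type*} (S : X → X → X → Prop) : Prop where
  symm : ∀ {x y z}, S x y z → S x z y
  trans : ∀ {x y z w}, S x y z → S x z w → S x y w
  refl : ∀ {x y}, x ≠ y → S x y y
  irrefl : ∀ {x y}, ¬ S x x y
  median : ∀ x y z, ∃ m, ¬ S m x y ∧ ¬ S m y z ∧ ¬ S m x z
  antisymm : ∀ {x y z}, ¬ S y x z → ¬ S z x y → y = z

namespace IsDirTree

variable {X : Type*} {S : X → X → X → Prop} (h : IsDirTree S)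

include h

theorem le_trans {r x y z : X} (hxy : ¬ S x r y) (hyz : ¬ S y r z) : ¬ S x r z := fun hxz => by
  by_cases hne : x = y
  · exact hyz (hne ▸ hxz)
  have h1 : ¬ S x z y := fun h1 => hxy (h.trans hxz h1)
  refine hne (h.antisymm h1 fun h2 => ?_)
  exact hne (h.antisymm hxy fun h3 => hyz (h.trans h3 (h.symm h2)))

theorem le_total_of_le {r x y z : X} (hxz : ¬ S x r z) (hyz : ¬ S y r z) :
    ¬ S x r y ∨ ¬ S y r x := by
  by_contra! hc
  obtain rfl : x = y := h.antisymm (x := z) (fun h1 => hxz (h.trans hc.1 (h.symm h1)))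
    (fun h1 => hyz (h.trans hc.2 (h.symm h1)))
  exact h.irrefl (h.symm hc.1)

theorem dir_of_lt_of_le {r m w x : X} (hmw : ¬ S m r w) (hne : m ≠ w) (hwx : ¬ S w r x) :
    S m w x := by
  by_contra h1
  have h2 : S w r m := by
    by_contra h2
    exact hne (h.antisymm hmw h2)
  exact hne (h.antisymm (x := x) (fun h3 => h1 (h.symm h3))
    fun h3 => hwx (h.trans h2 (h.symm h3)))

theorem le_inf {r x y m w : X} (hx : ¬ S m r x) (hxy : ¬ S m x y) (hwx : ¬ S w r x)
    (hwy : ¬ S w r y) : ¬ S w r m := by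
  rcases h.le_total_of_le hwx hx with h1 | h1
  · exact h1
  by_cases hne : m = w
  · exact hne ▸ fun h2 => h.irrefl (h.symm h2)
  exact absurd (h.trans (h.symm (h.dir_of_lt_of_le h1 hne hwx)) (h.dir_of_lt_of_le h1 hne hwy)) hxy

/-- The order on a median pretree with least element `r`. -/
@[reducible] noncomputable def semilatticeInf (r : X) : SemilatticeInf X where
  le x y := ¬ S x r y
  le_refl _ := fun h1 => h.irrefl (h.symm h1)
  le_trans _ _ _ := h.le_trans
  le_antisymm _ _ := h.antisymm
  inf x y := (h.median r x y).choose
  inf_le_left x y := (h.median r x y).choose_spec.1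
  inf_le_right x y := (h.median r x y).choose_spec.2.2
  le_inf _ x y := h.le_inf (h.median r x y).choose_spec.1 (h.median r x y).choose_spec.2.1

omit h in
/-- A set containing the medians of its points. -/
def MedianClosed (S : X → X → X → Prop) (V : Finset X) : Prop :=
  ∀ x ∈ V, ∀ y ∈ V, ∀ z ∈ V, ∀ m, ¬ S m x y → ¬ S m y z → ¬ S m x z → m ∈ V

omit h in
open Classical in
/-- The directions at points of `V` containing points of `V`. -/
noncomputable def dirs (S : X → X → X → Prop) (V : Finset X) : Finset (X × Set X) :=
  ((V ×ˢ V).filter fun p => p.1 ≠ p.2).image fun p => (p.1, {z | S p.1 p.2 z})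

omit h in
theorem mem_dirs {V : Finset X} {d : X × Set X} :
    d ∈ dirs S V ↔ ∃ v ∈ V, ∃ y ∈ V, v ≠ y ∧ d = (v, {z | S v y z}) := by
  simp only [dirs, Finset.mem_image, Finset.mem_filter, Finset.mem_product, Prod.exists]
  constructor
  · rintro ⟨v, y, ⟨⟨h1, h2⟩, h3⟩, rfl⟩
    exact ⟨v, h1, y, h2, h3, rfl⟩
  · rintro ⟨v, h1, y, h2, h3, rfl⟩
    exact ⟨v, y, ⟨⟨h1, h2⟩, h3⟩, rfl⟩

theorem dir_eq {v y z : X} (hyz : S v y z) : {w | S v y w} = {w | S v z w} := by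
  ext w
  exact ⟨h.trans (h.symm hyz), h.trans hyz⟩

theorem exists_medianClosed (P : Finset X) (hP : P.Nonempty) : ∃ V : Finset X, P ⊆ V ∧
    MedianClosed S V ∧ ∀ v ∈ V, v ∉ P → ∃ x ∈ P, ∃ y ∈ P, v ≠ x ∧ v ≠ y ∧ ¬ S v x y := by
  classical
  obtain ⟨r, hr⟩ := hP
  let _ := h.semilatticeInf r
  have tot : ∀ {x y z : X}, x ≤ z → y ≤ z → x ≤ y ∨ y ≤ x := fun h1 h2 => h.le_total_of_le h1 h2
  have hV1 : ∀ {x}, x ∈ (P ×ˢ P).image (fun p => p.1 ⊓ p.2) ↔ ∃ a ∈ P, ∃ b ∈ P, a ⊓ b = x := by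
    intro x
    simp only [Finset.mem_image, Finset.mem_product, Prod.exists]
    constructor
    · rintro ⟨a, b, ⟨ha, hb⟩, rfl⟩; exact ⟨a, ha, b, hb, rfl⟩
    · rintro ⟨a, ha, b, hb, rfl⟩; exact ⟨a, b, ⟨ha, hb⟩, rfl⟩
  have hV2 : ∀ {x c}, x ∈ (P ×ˢ P).image (fun p => p.1 ⊓ p.2) → c ∈ P →
      x ⊓ c ∈ (P ×ˢ P).image (fun p => p.1 ⊓ p.2) := by
    intro x c hx hc
    obtain ⟨a, ha, b, hb, rfl⟩ := hV1.1 hx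
    have h1 : a ⊓ b ⊓ c = (a ⊓ b) ⊓ (b ⊓ c) := by
      rw [inf_assoc, inf_assoc, ← inf_assoc b b c, inf_idem]
    rw [h1]
    rcases tot (inf_le_right : a ⊓ b ≤ b) (inf_le_left : b ⊓ c ≤ b) with h2 | h2
    · rw [inf_eq_left.2 h2]; exact hx
    · rw [inf_eq_right.2 h2]; exact hV1.2 ⟨b, hb, c, hc, rfl⟩
  have hV3 : ∀ {x y}, x ∈ (P ×ˢ P).image (fun p => p.1 ⊓ p.2) →
      y ∈ (P ×ˢ P).image (fun p => p.1 ⊓ p.2) → ∀ {m}, ¬ S m r x → ¬ S m r y → ¬ S m x y →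
      m ∈ (P ×ˢ P).image (fun p => p.1 ⊓ p.2) := by
    intro x y hx hy m h1 h2 h3
    have : m = x ⊓ y := by
      refine le_antisymm (_root_.le_inf (show m ≤ x from h1) (show m ≤ y from h2)) ?_
      exact h.le_inf h1 h3 (inf_le_left : x ⊓ y ≤ x) (inf_le_right : x ⊓ y ≤ y)
    rw [this]
    obtain ⟨a, ha, b, hb, rfl⟩ := hV1.1 hy
    rw [← inf_assoc]
    exact hV2 (hV2 hx ha) hb
  refine ⟨(P ×ˢ P).image fun p => p.1 ⊓ p.2, ?_, ?_, ?_⟩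
  · intro x hx
    exact hV1.2 ⟨x, hx, x, hx, inf_idem x⟩
  · intro x hx y hy z hz m h1 h2 h3
    by_cases hmx : S m r x
    · have hmy : ¬ S m r y := fun h4 => h1 (h.trans (h.symm hmx) h4)
      have hmz : ¬ S m r z := fun h4 => h3 (h.trans (h.symm hmx) h4)
      exact hV3 hy hz hmy hmz h2
    · by_cases hmy : S m r y
      · have hmz : ¬ S m r z := fun h4 => h2 (h.trans (h.symm hmy) h4)
        exact hV3 hx hz hmx hmz h3
      · exact hV3 hx hy hmx hmy h1
  · intro v hv hvP
    obtain ⟨a, ha, b, hb, rfl⟩ := hV1.1 hv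
    exact ⟨a, ha, b, hb, fun h1 => hvP (by rw [h1]; exact ha),
      fun h1 => hvP (by rw [h1]; exact hb),
      (h.median r a b).choose_spec.2.1⟩

/-- A finite median pretree with `n` points has `2 (n - 1)` directions. -/
theorem card_dirs {V : Finset X} (hV : MedianClosed S V) (hne : V.Nonempty) :
    (dirs S V).card + 2 = 2 * V.card := by
  classical
  obtain ⟨r, hr⟩ := hne
  let _ := h.semilatticeInf r
  have tot : ∀ {x y z : X}, x ≤ z → y ≤ z → x ≤ y ∨ y ≤ x := fun h1 h2 => h.le_total_of_le h1 h2
  have bot : ∀ x : X, r ≤ x := fun x => h.irrefl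
  have hpar : ∀ u : X, ∃ p, u ∈ V.erase r → p ∈ V ∧ p < u ∧ ∀ w ∈ V, w < u → w ≤ p := by
    intro u
    by_cases hu : u ∈ V.erase r
    · have hu' := Finset.mem_erase.1 hu
      obtain ⟨p, hp⟩ := (V.filter (· < u)).exists_maximal
        ⟨r, Finset.mem_filter.2 ⟨hr, lt_of_le_of_ne (bot u) hu'.1.symm⟩⟩
      have hp1 := Finset.mem_filter.1 hp.1
      refine ⟨p, fun _ => ⟨hp1.1, hp1.2, fun w hw hwu => ?_⟩⟩
      rcases tot hwu.le hp1.2.le with h1 | h1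
      · exact h1
      · exact hp.2 (Finset.mem_filter.2 ⟨hw, hwu⟩) h1
    · exact ⟨r, fun h1 => absurd h1 hu⟩
  choose par hpar using hpar
  have lt_dir : ∀ {m w x : X}, m < w → w ≤ x → S m w x := fun h1 h2 =>
    h.dir_of_lt_of_le h1.le h1.ne h2
  have hcover : dirs S V = (V.erase r).image (fun v => (v, {z | S v r z})) ∪
      (V.erase r).image (fun u => (par u, {z | S (par u) u z})) := by
    ext d
    rw [mem_dirs, Finset.mem_union, Finset.mem_image, Finset.mem_image]
    constructor
    · rintro ⟨v, hv, y, hy, hvy, rfl⟩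
      by_cases h1 : S v y r
      · left
        refine ⟨v, Finset.mem_erase.2 ⟨?_, hv⟩, ?_⟩
        · rintro rfl; exact h.irrefl (h.symm h1)
        · rw [h.dir_eq h1]
      · right
        have hlt : v < y := lt_of_le_of_ne (fun h2 => h1 (h.symm h2)) hvy
        obtain ⟨u, hu⟩ := (V.filter fun w => v < w ∧ w ≤ y).exists_minimal
          ⟨y, Finset.mem_filter.2 ⟨hy, hlt, le_rfl⟩⟩
        obtain ⟨huV, hvu, huy⟩ := Finset.mem_filter.1 hu.1
        have hue : u ∈ V.erase r := Finset.mem_erase.2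
          ⟨fun h2 => absurd (bot v) (h2 ▸ hvu).not_ge, huV⟩
        obtain ⟨hp1, hp2, hp3⟩ := hpar u hue
        have hpv : par u = v := by
          by_contra h2
          have h3 : v < par u := lt_of_le_of_ne (hp3 v hv hvu) (Ne.symm h2)
          exact absurd (hu.2 (Finset.mem_filter.2 ⟨hp1, h3, hp2.le.trans huy⟩) hp2.le) hp2.not_ge
        refine ⟨u, hue, ?_⟩
        rw [hpv, h.dir_eq (lt_dir hvu huy)]
    · rintro (⟨v, hv, rfl⟩ | ⟨u, hu, rfl⟩)
      · exact ⟨v, (Finset.mem_erase.1 hv).2, r, hr, (Finset.mem_erase.1 hv).1, rfl⟩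
      · obtain ⟨hp1, hp2, -⟩ := hpar u hu
        exact ⟨_, hp1, u, (Finset.mem_erase.1 hu).2, hp2.ne, rfl⟩
  have hdisj : Disjoint ((V.erase r).image (fun v => (v, {z | S v r z})))
      ((V.erase r).image (fun u => (par u, {z | S (par u) u z}))) := by
    rw [Finset.disjoint_left]
    intro d hd hd'
    obtain ⟨v, hv, rfl⟩ := Finset.mem_image.1 hd
    obtain ⟨u, hu, hvu⟩ := Finset.mem_image.1 hd'
    obtain ⟨hp1, hp2, -⟩ := hpar u hu
    obtain ⟨rfl, h2⟩ := Prod.ext_iff.1 hvu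
    have h3 : u ∈ {z | S (par u) u z} := h.refl hp2.ne
    have h2' : {z | S (par u) u z} = {z | S (par u) r z} := h2
    rw [h2'] at h3
    exact hp2.le h3
  rw [hcover, Finset.card_union_of_disjoint hdisj, Finset.card_image_of_injOn,
    Finset.card_image_of_injOn, Finset.card_erase_of_mem hr]
  · have : 0 < V.card := Finset.card_pos.2 ⟨r, hr⟩
    omega
  · intro u hu u' hu' huu
    obtain ⟨hp1, hp2, hp3⟩ := hpar u hu
    obtain ⟨hp1', hp2', hp3'⟩ := hpar u' hu'
    obtain ⟨e1, e2⟩ := Prod.ext_iff.1 huu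
    have e1' : par u = par u' := e1
    have e2' : {z | S (par u) u z} = {z | S (par u') u' z} := e2
    have h1 : S (par u) u u' := by
      have : u' ∈ {z | S (par u') u' z} := h.refl hp2'.ne
      rwa [← e2'] at this
    have hm := (h.median r u u').choose_spec
    have hmV : u ⊓ u' ∈ V := hV r hr u (Finset.mem_erase.1 hu).2 u' (Finset.mem_erase.1 hu').2 _
      hm.1 hm.2.1 hm.2.2
    have hne : u ⊓ u' ≠ par u := fun h2 => by
      have h3 : ¬ S (u ⊓ u') u u' := hm.2.1
      rw [h2] at h3
      exact h3 h1
    have hle : par u ≤ u ⊓ u' := _root_.le_inf hp2.le (e1' ▸ hp2'.le)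
    have h4 : u ⊓ u' = u := by
      by_contra h5
      exact hne (le_antisymm (hp3 _ hmV (lt_of_le_of_ne inf_le_left h5)) hle)
    have h5 : u ⊓ u' = u' := by
      by_contra h5
      exact hne (le_antisymm (e1' ▸ hp3' _ hmV (lt_of_le_of_ne inf_le_right h5)) hle)
    exact h4.symm.trans h5
  · intro v _ v' _ hvv
    exact (Prod.ext_iff.1 hvv).1

end IsDirTree

section

open Finset Pointwise

variable {ι : Type*} [Fintype ι]

theorem card_schreierEdges_eq_sum {Ω : Type*} [DecidableEq Ω] [MulAction (FreeGroup ι) Ω]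
    (P : Finset Ω) : #(schreierEdges (ι := ι) P) = ∑ i : ι, #{q ∈ P | FreeGroup.of i • q ∈ P} := by
  simp only [schreierEdges, card_filter, sum_product]

namespace IsDirTree

/-- If a free group of rank `m` acts on a median pretree with abelian direction stabilizers, then
every ball in a point stabilizer lies in an `m`-generated subgroup of the stabilizer. -/
theorem exists_generators {X : Type*} [MulAction (FreeGroup ι) X] {S : X → X → X → Prop}
    (h : IsDirTree S)
    (hS : ∀ (g : FreeGroup ι) x y z, S (g • x) (g • y) (g • z) ↔ S x y z)
    (hcomm : ∀ x y, x ≠ y → ∀ g k : FreeGroup ι, g • x = x → S x y (g • y) → k • x = x →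
      S x y (k • y) → g * k = k * g) (x₀ : X) (N : ℕ) :
    ∃ T : Finset (FreeGroup ι), #T ≤ Fintype.card ι ∧ (∀ g ∈ T, g • x₀ = x₀) ∧
      ∀ w : List (ι × Bool), w.length ≤ N → FreeGroup.mk w • x₀ = x₀ →
        FreeGroup.mk w ∈ Subgroup.closure (T : Set (FreeGroup ι)) := by
  classical
  let W : Finset (List (ι × Bool)) := (List.finite_length_le (ι × Bool) N).toFinset
  have hW : ∀ {w}, w ∈ W ↔ w.length ≤ N := by simp [W]
  let P : Finset X := W.image fun w => FreeGroup.mk w • x₀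
  have hwP : ∀ {w : List (ι × Bool)}, w.length ≤ N → FreeGroup.mk w • x₀ ∈ P := fun hw =>
    mem_image.2 ⟨_, hW.2 hw, rfl⟩
  have hx₀ : x₀ ∈ P := by
    have := hwP (w := []) (by simp)
    rwa [← FreeGroup.one_eq_mk, one_smul] at this
  obtain ⟨V, hPV, hV, hVP⟩ := h.exists_medianClosed P ⟨x₀, hx₀⟩
  have hsuf : ∀ w : List (ι × Bool), w.length ≤ N → ∀ v, v <:+ w → FreeGroup.mk v • x₀ ∈ V :=
    fun w hw v hv => hPV (hwP (hv.length_le.trans hw))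
  have hdir : ∀ (g : FreeGroup ι) (v y : X), g • (v, {z | S v y z}) =
      (g • v, {z | S (g • v) (g • y) z}) := by
    intro g v y
    refine Prod.ext rfl ?_
    ext z
    change z ∈ g • {z | S v y z} ↔ _
    rw [Set.mem_smul_set_iff_inv_smul_mem]
    change S v y (g⁻¹ • z) ↔ S (g • v) (g • y) z
    rw [← hS g, smul_inv_smul]
  suffices hV' : ∃ T : Finset (FreeGroup ι), #T ≤ Fintype.card ι ∧ (∀ g ∈ T, g • x₀ = x₀) ∧
      ∀ w : List (ι × Bool), (∀ v, v <:+ w → FreeGroup.mk v • x₀ ∈ V) →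
        FreeGroup.mk w • x₀ = x₀ → FreeGroup.mk w ∈ Subgroup.closure (T : Set (FreeGroup ι)) by
    obtain ⟨T, hT, hTs, hTw⟩ := hV'
    exact ⟨T, hT, hTs, fun w hw => hTw w (hsuf w hw)⟩
  refine exists_generators_of_fibers (ι := ι) (Prod.fst : X × Set X → X)
    (fun _ _ => rfl) V (dirs S V) (fun ω hω => ?_) (hPV hx₀) ?_ ?_ ?_
  · obtain ⟨v, hv, y, hy, -, rfl⟩ := mem_dirs.1 hω
    exact hv
  · intro p hp hpw
    have hpP : p ∉ P := fun h1 => by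
      obtain ⟨w, hw, rfl⟩ := mem_image.1 h1
      exact hpw w (hsuf w (hW.1 hw)) rfl
    obtain ⟨x, hx, y, hy, hpx, hpy, hxy⟩ := hVP p hp hpP
    refine one_lt_card.2 ⟨(p, {z | S p x z}), ?_, (p, {z | S p y z}), ?_, fun h1 => hxy ?_⟩
    · exact mem_filter.2 ⟨mem_dirs.2 ⟨p, hp, x, hPV hx, hpx, rfl⟩, rfl⟩
    · exact mem_filter.2 ⟨mem_dirs.2 ⟨p, hp, y, hPV hy, hpy, rfl⟩, rfl⟩
    · have h2 : {z | S p x z} = {z | S p y z} := (Prod.ext_iff.1 h1).2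
      have h3 : y ∈ {z | S p y z} := h.refl hpy
      rwa [← h2] at h3
  · intro d hd g k hg hk
    obtain ⟨v, hv, y, hy, hvy, rfl⟩ := mem_dirs.1 hd
    have key : ∀ g : FreeGroup ι, g • (v, {z | S v y z}) = (v, {z | S v y z}) →
        g • v = v ∧ S v y (g • y) := by
      intro g hg
      rw [hdir] at hg
      have h1 : g • v = v := (Prod.ext_iff.1 hg).1
      have h2 : {z | S (g • v) (g • y) z} = {z | S v y z} := (Prod.ext_iff.1 hg).2
      have h3 : g • y ∈ {z | S (g • v) (g • y) z} := (hS g v y y).2 (h.refl hvy)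
      rw [h2] at h3
      exact ⟨h1, h3⟩
    exact hcomm v y hvy g k (key g hg).1 (key g hg).2 (key k hk).1 (key k hk).2
  · have h1 := h.card_dirs hV ⟨x₀, hPV hx₀⟩
    suffices 2 * #(schreierEdges (ι := ι) V) ≤
        #(schreierEdges (ι := ι) (dirs S V)) + 2 * Fintype.card ι by omega
    rw [card_schreierEdges_eq_sum, card_schreierEdges_eq_sum, mul_sum]
    have h2 : 2 * Fintype.card ι = ∑ _i : ι, 2 := by simp [mul_comm]
    rw [h2, ← sum_add_distrib]
    refine sum_le_sum fun i _ => ?_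
    set Vi := V.filter fun q => FreeGroup.of i • q ∈ V with hVi
    have hmem : ∀ {x}, x ∈ Vi ↔ x ∈ V ∧ FreeGroup.of i • x ∈ V := by simp [hVi]
    obtain h3 | h3 := Vi.eq_empty_or_nonempty
    · simp [h3]
    have hVim : MedianClosed S Vi := by
      intro x hx y hy z hz m h1 h2 h3
      rw [hmem] at hx hy hz ⊢
      refine ⟨hV x hx.1 y hy.1 z hz.1 m h1 h2 h3, hV _ hx.2 _ hy.2 _ hz.2 _ ?_ ?_ ?_⟩ <;>
        rwa [hS]
    rw [← h.card_dirs hVim h3]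
    gcongr
    intro d hd
    obtain ⟨v, hv, y, hy, hvy, rfl⟩ := mem_dirs.1 hd
    rw [hmem] at hv hy
    rw [mem_filter, hdir]
    exact ⟨mem_dirs.2 ⟨v, hv.1, y, hy.1, hvy, rfl⟩,
      mem_dirs.2 ⟨_, hv.2, _, hy.2, (MulAction.injective _).ne hvy, rfl⟩⟩

end IsDirTree
end

section

namespace FreeGroup

variable {α : Type*} [DecidableEq α] {J : Type*}

/-- The families in a free group whose norms are bounded along an ultrafilter. -/
def boundedSubgroup (α : Type*) [DecidableEq α] (U : Ultrafilter J) :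
    Subgroup (J → FreeGroup α) where
  carrier := {a | ∃ R, ∀ᶠ j in (U : Filter J), norm (a j) ≤ R}
  one_mem' := ⟨0, by simp⟩
  mul_mem' := by
    rintro a b ⟨R, hR⟩ ⟨R', hR'⟩
    refine ⟨R + R', ?_⟩
    filter_upwards [hR, hR'] with j h1 h2
    exact (norm_mul_le _ _).trans (add_le_add h1 h2)
  inv_mem' := by
    rintro a ⟨R, hR⟩
    exact ⟨R, by simpa using hR⟩

theorem mem_boundedSubgroup {U : Ultrafilter J} {a : J → FreeGroup α} :
    a ∈ boundedSubgroup α U ↔ ∃ R, ∀ᶠ j in (U : Filter J), norm (a j) ≤ R := Iff.rfl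

/-- `b` and `c` fellow travel from `a` for an unbounded time along an ultrafilter. -/
def FarTogether (U : Ultrafilter J) (a b c : J → FreeGroup α) : Prop :=
  ∀ R, ∀ᶠ j in (U : Filter J),
    norm ((b j)⁻¹ * c j) + R < norm ((a j)⁻¹ * b j) + norm ((a j)⁻¹ * c j)

theorem not_farTogether {U : Ultrafilter J} {a b c : J → FreeGroup α} :
    ¬ FarTogether U a b c ↔ ∃ R, ∀ᶠ j in (U : Filter J),
      norm ((a j)⁻¹ * b j) + norm ((a j)⁻¹ * c j) ≤ norm ((b j)⁻¹ * c j) + R := by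
  simp [FarTogether]

theorem FarTogether.congr {U : Ultrafilter J} {a b c a' b' c' : J → FreeGroup α}
    (h : FarTogether U a b c) (ha : a⁻¹ * a' ∈ boundedSubgroup α U)
    (hb : b⁻¹ * b' ∈ boundedSubgroup α U) (hc : c⁻¹ * c' ∈ boundedSubgroup α U) :
    FarTogether U a' b' c' := by
  intro R
  obtain ⟨R₁, h₁⟩ := ha
  obtain ⟨R₂, h₂⟩ := hb
  obtain ⟨R₃, h₃⟩ := hc
  filter_upwards [h (R + 2 * R₁ + 2 * R₂ + 2 * R₃), h₁, h₂, h₃] with j h0 h1 h2 h3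
  simp only [Pi.mul_apply, Pi.inv_apply] at h1 h2 h3
  have t1 := norm_triangle (a j) (a' j) (b j)
  have t2 := norm_triangle (a' j) (b' j) (b j)
  have t3 := norm_triangle (a j) (a' j) (c j)
  have t4 := norm_triangle (a' j) (c' j) (c j)
  have t5 := norm_triangle (b' j) (b j) (c' j)
  have t6 := norm_triangle (b j) (c j) (c' j)
  have e1 := norm_inv_mul_comm (b j) (b' j)
  have e2 := norm_inv_mul_comm (c j) (c' j)
  omega

/-- The relation induced by `FarTogether` on bounded classes. -/
def sameDirection (U : Ultrafilter J) (x y z : (J → FreeGroup α) ⧸ boundedSubgroup α U) : Prop :=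
  FarTogether U x.out y.out z.out

theorem sameDirection_mk {U : Ultrafilter J} {a b c : J → FreeGroup α} :
    sameDirection U (a : (J → FreeGroup α) ⧸ boundedSubgroup α U) b c ↔ FarTogether U a b c := by
  have h : ∀ a : J → FreeGroup α, (a⁻¹ * (a : (J → FreeGroup α) ⧸ boundedSubgroup α U).out ∈
      boundedSubgroup α U) ∧ ((a : (J → FreeGroup α) ⧸ boundedSubgroup α U).out⁻¹ * a ∈
      boundedSubgroup α U) := fun a =>
    ⟨QuotientGroup.eq.1 (QuotientGroup.out_eq' _).symm, QuotientGroup.eq.1 (QuotientGroup.out_eq' _)⟩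
  exact ⟨fun h1 => h1.congr (h a).2 (h b).2 (h c).2, fun h1 => h1.congr (h a).1 (h b).1 (h c).1⟩

theorem isDirTree_sameDirection (U : Ultrafilter J) :
    IsDirTree (sameDirection (α := α) U) where
  symm {x y z} := by
    induction x using QuotientGroup.induction_on with | H a
    induction y using QuotientGroup.induction_on with | H b
    induction z using QuotientGroup.induction_on with | H c
    simp only [sameDirection_mk]
    intro h R
    filter_upwards [h R] with j hj
    have := norm_inv_mul_comm (b j) (c j)
    omega
  trans {x y z w} := by
    induction x using QuotientGroup.induction_on with | H a
    induction y using QuotientGroup.induction_on with | H b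
    induction z using QuotientGroup.induction_on with | H c
    induction w using QuotientGroup.induction_on with | H d
    simp only [sameDirection_mk]
    intro h1 h2 R
    filter_upwards [h1 R, h2 R] with j h1 h2
    have := norm_hyperbolic (a j) (b j) (c j) (d j)
    omega
  refl {x y} := by
    induction x using QuotientGroup.induction_on with | H a
    induction y using QuotientGroup.induction_on with | H b
    simp only [sameDirection_mk]
    intro h R
    have h1 : ¬ a⁻¹ * b ∈ boundedSubgroup α U := fun h1 => h (QuotientGroup.eq.2 h1)
    rw [mem_boundedSubgroup] at h1
    simp only [not_exists, ← Ultrafilter.eventually_not] at h1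
    filter_upwards [h1 R] with j hj
    simp only [Pi.mul_apply, Pi.inv_apply] at hj
    simp
    omega
  irrefl {x y} := by
    induction x using QuotientGroup.induction_on with | H a
    induction y using QuotientGroup.induction_on with | H b
    simp only [sameDirection_mk]
    intro h
    obtain ⟨j, hj⟩ := (h 0).exists
    simp at hj
  median x y z := by
    induction x using QuotientGroup.induction_on with | H a
    induction y using QuotientGroup.induction_on with | H b
    induction z using QuotientGroup.induction_on with | H c
    choose m h1 h2 h3 using fun j => exists_median (a j) (b j) (c j)
    refine ⟨(m : J → FreeGroup α), ?_⟩
    simp only [sameDirection_mk, not_farTogether]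
    refine ⟨⟨0, Eventually.of_forall fun j => ?_⟩, ⟨0, Eventually.of_forall fun j => ?_⟩,
      ⟨0, Eventually.of_forall fun j => ?_⟩⟩
    · have := norm_inv_mul_comm (a j) (m j)
      have := h1 j
      omega
    · have := norm_inv_mul_comm (b j) (m j)
      have := h2 j
      omega
    · have := norm_inv_mul_comm (a j) (m j)
      have := h3 j
      omega
  antisymm {x y z} := by
    induction x using QuotientGroup.induction_on with | H a
    induction y using QuotientGroup.induction_on with | H b
    induction z using QuotientGroup.induction_on with | H c
    simp only [sameDirection_mk, not_farTogether]
    rintro ⟨R, h1⟩ ⟨R', h2⟩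
    refine QuotientGroup.eq.2 ⟨R + R', ?_⟩
    filter_upwards [h1, h2] with j h1 h2
    have e1 := norm_inv_mul_comm (b j) (c j)
    have e2 := norm_inv_mul_comm (a j) (c j)
    have e3 := norm_inv_mul_comm (a j) (b j)
    simp only [Pi.mul_apply, Pi.inv_apply]
    omega

/-- Let `f j` be homomorphisms between free groups which eventually separate each element from `1`.
Every ball in the subgroup where the `f j` stay bounded lies in a subgroup of it with at most as
many generators as the source. -/
theorem exists_generators_of_homs {ι : Type*} [Fintype ι] (U : Ultrafilter J)
    (f : J → FreeGroup ι →* FreeGroup α)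
    (hf : ∀ k, k ≠ 1 → ∀ᶠ j in (U : Filter J), f j k ≠ 1) (N : ℕ) :
    ∃ T : Finset (FreeGroup ι), T.card ≤ Fintype.card ι ∧
      (∀ g ∈ T, ∃ R, ∀ᶠ j in (U : Filter J), norm (f j g) ≤ R) ∧
      ∀ w : List (ι × Bool), w.length ≤ N →
        (∃ R, ∀ᶠ j in (U : Filter J), norm (f j (mk w)) ≤ R) →
        mk w ∈ Subgroup.closure (T : Set (FreeGroup ι)) := by
  let φ : FreeGroup ι →* (J → FreeGroup α) := MonoidHom.pi f
  let _ : MulAction (FreeGroup ι) ((J → FreeGroup α) ⧸ boundedSubgroup α U) :=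
    MulAction.compHom _ φ
  have hsmul : ∀ (g : FreeGroup ι) (a : J → FreeGroup α),
      g • (a : (J → FreeGroup α) ⧸ boundedSubgroup α U) = ((φ g * a : J → FreeGroup α) :
        (J → FreeGroup α) ⧸ boundedSubgroup α U) := fun _ _ => rfl
  have hφ : ∀ g j, φ g j = f j g := fun _ _ => rfl
  have hstab : ∀ g : FreeGroup ι, g • ((1 : J → FreeGroup α) :
      (J → FreeGroup α) ⧸ boundedSubgroup α U) = ((1 : J → FreeGroup α) :
      (J → FreeGroup α) ⧸ boundedSubgroup α U) ↔
      ∃ R, ∀ᶠ j in (U : Filter J), norm (f j g) ≤ R := by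
    intro g
    rw [hsmul, eq_comm, QuotientGroup.eq]
    simp [mem_boundedSubgroup, hφ]
  suffices h : ∃ T : Finset (FreeGroup ι), T.card ≤ Fintype.card ι ∧
      (∀ g ∈ T, g • ((1 : J → FreeGroup α) : (J → FreeGroup α) ⧸ boundedSubgroup α U) =
        ((1 : J → FreeGroup α) : (J → FreeGroup α) ⧸ boundedSubgroup α U)) ∧
      ∀ w : List (ι × Bool), w.length ≤ N →
        mk w • ((1 : J → FreeGroup α) : (J → FreeGroup α) ⧸ boundedSubgroup α U) =
          ((1 : J → FreeGroup α) : (J → FreeGroup α) ⧸ boundedSubgroup α U) →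
        mk w ∈ Subgroup.closure (T : Set (FreeGroup ι)) by
    simpa only [hstab] using h
  refine (isDirTree_sameDirection (α := α) U).exists_generators ?_ ?_ _ N
  · intro g x y z
    induction x using QuotientGroup.induction_on with | H a
    induction y using QuotientGroup.induction_on with | H b
    induction z using QuotientGroup.induction_on with | H c
    simp only [hsmul, sameDirection_mk]
    simp [FarTogether, mul_assoc]
  · intro x y hxy g k
    induction x using QuotientGroup.induction_on with | H a
    induction y using QuotientGroup.induction_on with | H b
    simp only [hsmul, sameDirection_mk]
    intro hg hgS hk hkS
    obtain ⟨R₁, h₁⟩ := QuotientGroup.eq.1 hg.symm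
    obtain ⟨R₂, h₂⟩ := QuotientGroup.eq.1 hk.symm
    have hev : ∀ᶠ j in (U : Filter J), f j (g * k * (k * g)⁻¹) = 1 := by
      filter_upwards [h₁, h₂, hgS (8 * (R₁ + R₂) + 8), hkS (8 * (R₁ + R₂) + 8)] with j h1 h2 h3 h4
      simp only [Pi.mul_apply, Pi.inv_apply, hφ] at h1 h2 h3 h4
      have := commute_of_norm_le (g := (a j)⁻¹ * (f j g * a j)) (h := (a j)⁻¹ * (f j k * a j))
        (y := (a j)⁻¹ * b j) (R := R₁ + R₂) (by omega) (by omega)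
        (by simp only [mul_assoc, mul_inv_rev, inv_inv, mul_inv_cancel_left] at *; omega)
        (by simp only [mul_assoc, mul_inv_rev, inv_inv, mul_inv_cancel_left] at *; omega)
      simp only [mul_assoc, mul_inv_cancel_left, mul_left_cancel_iff] at this
      rw [← mul_assoc, ← mul_assoc, mul_right_cancel_iff] at this
      rw [_root_.map_mul, _root_.map_inv, _root_.map_mul, _root_.map_mul, this, mul_inv_cancel]
    by_contra hne
    obtain ⟨j, h1, h2⟩ := (hev.and (hf (g * k * (k * g)⁻¹) fun h3 => hne (mul_inv_eq_one.1 h3))).exists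
    exact h2 h1

end FreeGroup
end

theorem finite_minimal_hitting {β σ : Type*} [DecidableEq β] (H : σ → Finset β) (n : ℕ)
    (hmin : ∀ T : Finset β, (∀ x, ∃ b ∈ H x, b ∈ T) → n ≤ T.card) (B : Finset β) :
    {T : Finset β | B ⊆ T ∧ T.card = n ∧ ∀ x, ∃ b ∈ H x, b ∈ T}.Finite := by
  induction hd : n - B.card generalizing B with
  | zero =>
    refine (Set.finite_singleton B).subset ?_
    rintro T ⟨h1, h2, -⟩
    exact (Finset.eq_of_subset_of_card_le h1 (by omega)).symm
  | succ d ih =>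
    have h1 : ¬ ∀ x, ∃ b ∈ H x, b ∈ B := fun h1 => by
      have := hmin B h1
      omega
    push Not at h1
    obtain ⟨x, hx⟩ := h1
    refine ((H x).finite_toSet.biUnion (t := fun b => {T : Finset β | insert b B ⊆ T ∧ T.card = n ∧
      ∀ x, ∃ b ∈ H x, b ∈ T}) fun b hb => ih (insert b B) ?_).subset ?_
    · rw [Finset.card_insert_of_notMem (hx b hb)]
      omega
    · rintro T ⟨h2, h3, h4⟩
      obtain ⟨b, hb, hbT⟩ := h4 x
      exact Set.mem_biUnion hb ⟨Finset.insert_subset hbT h2, h3, h4⟩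

section

variable {L : FirstOrder.Language} {M : Type*} [L.Structure M] {A : Set M}

theorem definable_term_eq {γ : Type*} (t s : L.Term γ) :
    A.Definable L {v : γ → M | t.realize v = s.realize v} := by
  refine Set.Definable.mono (A := ∅) ?_ (Set.empty_subset _)
  rw [Set.empty_definable_iff]
  refine ⟨t.equal s, ?_⟩
  ext v
  simp [Language.Formula.realize_equal]

theorem mem_Lacl_of_definable {Y : Set (Fin 1 → M)} (hY : A.Definable L Y) (hfin : Y.Finite)
    {b : M} (hb : (fun _ => b) ∈ Y) : b ∈ Lacl L A := by
  obtain ⟨φ, rfl⟩ := Set.definable_iff_exists_formula_sum.1 hY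
  refine ⟨φ, ?_, hb⟩
  refine Set.Finite.of_finite_image (f := fun c => (fun _ : Fin 1 => c)) (hfin.subset ?_) ?_
  · rintro _ ⟨c, hc, rfl⟩
    exact hc
  · intro c _ c' _ h
    exact congrFun h 0

/-- A definable family containing a point whose images under some terms are not algebraic contains
a point whose images avoid a given finite set. -/
theorem exists_mem_forall_realize_notMem {ι κ : Type*} [Finite ι] [Fintype κ]
    {X : Set (ι → M)} (hX : A.Definable L X) (t : κ → L.Term ι) {x₀ : ι → M} (hx₀ : x₀ ∈ X)
    (hacl : ∀ k, (t k).realize x₀ ∉ Lacl L A) {Q : Set M} (hQ : Q.Finite) :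
    ∃ x ∈ X, ∀ k, (t k).realize x ∉ Q := by
  classical
  by_contra! hcon
  let H : X → Finset (κ × M) := fun x => Finset.univ.image fun k => (k, (t k).realize x.1)
  have hH : ∀ {x : X} {b}, b ∈ H x ↔ (t b.1).realize x.1 = b.2 := by
    intro x b
    simp only [H, Finset.mem_image, Finset.mem_univ, true_and]
    constructor
    · rintro ⟨k, rfl⟩; rfl
    · intro h; exact ⟨b.1, Prod.ext rfl h⟩
  have hex : ∃ n, ∃ T : Finset (κ × M), T.card = n ∧ ∀ x, ∃ b ∈ H x, b ∈ T := by
    refine ⟨_, Finset.univ ×ˢ hQ.toFinset, rfl, fun x => ?_⟩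
    obtain ⟨k, hk⟩ := hcon x.1 x.2
    exact ⟨(k, (t k).realize x.1), hH.2 rfl, by simpa using hk⟩
  obtain ⟨T, hTn, hT⟩ := Nat.find_spec hex
  have hmin : ∀ T' : Finset (κ × M), (∀ x, ∃ b ∈ H x, b ∈ T') → Nat.find hex ≤ T'.card :=
    fun T' hT' => Nat.find_min' hex ⟨T', rfl, hT'⟩
  generalize Nat.find hex = n at hTn hmin
  have hfin := finite_minimal_hitting H n hmin ∅
  obtain ⟨b, hb, hbT⟩ := hT ⟨x₀, hx₀⟩
  let e : Fin n ≃ T := (finCongr hTn.symm).trans T.equivFin.symm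
  let Z : Set (Fin n → M) := {q | ∀ x : ι → M, Sum.elim q x ∈
    {v : Fin n ⊕ ι → M | v ∘ Sum.inr ∈ X}ᶜ ∪
      ⋃ i : Fin n, {v : Fin n ⊕ ι → M | ((t (e i).1.1).relabel Sum.inr).realize v =
        (Language.Term.var (Sum.inl i) : L.Term (Fin n ⊕ ι)).realize v}}
  have hZ : A.Definable L Z := by
    refine Set.Definable.forall_of_finite (Set.Definable.union (Set.Definable.compl ?_)
      (Set.definable_iUnion_of_finite fun i => definable_term_eq _ _))
    exact hX.preimage_comp Sum.inr
  have hZmem : ∀ {q}, q ∈ Z ↔ ∀ x ∈ X, ∃ i, (t (e i).1.1).realize x = q i := by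
    intro q
    simp only [Z, Set.mem_ofPred_eq, Set.mem_union, Set.mem_compl_iff, Set.mem_iUnion,
      Language.Term.realize_relabel, Sum.elim_comp_inr, Language.Term.realize_var, Sum.elim_inl]
    exact forall_congr' fun x => by tauto
  let i₀ : Fin n := e.symm ⟨b, hbT⟩
  have hi₀ : (e i₀).1 = b := by simp [i₀]
  refine hacl b.1 (mem_Lacl_of_definable (hZ.image_comp (fun _ : Fin 1 => i₀)) ?_ ?_)
  · have h1 : (⋃ T ∈ {T : Finset (κ × M) | ∅ ⊆ T ∧ T.card = n ∧ ∀ x, ∃ b ∈ H x, b ∈ T},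
        ((fun a : κ × M => (fun _ : Fin 1 => a.2)) '' (T : Set (κ × M)))).Finite :=
      hfin.biUnion fun T _ => T.finite_toSet.image _
    refine h1.subset ?_
    rintro _ ⟨q, hq, rfl⟩
    rw [hZmem] at hq
    let T' : Finset (κ × M) := Finset.univ.image fun i => ((e i).1.1, q i)
    have hT' : ∀ x, ∃ b ∈ H x, b ∈ T' := fun x => by
      obtain ⟨i, hi⟩ := hq x.1 x.2
      exact ⟨_, hH.2 hi, Finset.mem_image_of_mem _ (Finset.mem_univ i)⟩
    have hcard : T'.card = n := by
      refine le_antisymm (Finset.card_image_le.trans ?_) (hmin T' hT')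
      simp
    refine Set.mem_biUnion (x := T') ⟨Finset.empty_subset _, hcard, hT'⟩ ?_
    exact ⟨_, Finset.mem_coe.2 (Finset.mem_image_of_mem _ (Finset.mem_univ i₀)), rfl⟩
  · refine ⟨fun i => (e i).1.2, hZmem.2 fun x hx => ?_, ?_⟩
    · obtain ⟨a, ha, haT⟩ := hT ⟨x, hx⟩
      exact ⟨e.symm ⟨a, haT⟩, by simpa using hH.1 ha⟩
    · funext j
      rw [hH] at hb
      simp only [Function.comp_apply, hi₀]
      exact hb.symm

end

section

variable {G : Type*} [Group G] {ι : Type*}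

/-- The group term spelled by a word. -/
def wordTerm : List (ι × Bool) → grpLang.Term ι
  | [] => Language.Term.func (l := 0) GrpFunc.one ![]
  | (i, true) :: w => Language.Term.func (l := 2) GrpFunc.mul ![Language.Term.var i, wordTerm w]
  | (i, false) :: w => Language.Term.func (l := 2) GrpFunc.mul
      ![Language.Term.func (l := 1) GrpFunc.inv ![Language.Term.var i], wordTerm w]

theorem realize_wordTerm (x : ι → G) (w : List (ι × Bool)) :
    (wordTerm w).realize x = FreeGroup.lift x (FreeGroup.mk w) := by
  induction w with
  | nil => rfl
  | cons a w ih =>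
    obtain ⟨i, b⟩ := a
    have hmk : FreeGroup.mk ((i, b) :: w) = FreeGroup.mk [(i, b)] * FreeGroup.mk w := by
      rw [FreeGroup.mul_mk]; rfl
    rw [hmk, map_mul, ← ih]
    cases b with
    | true =>
      have : FreeGroup.lift x (FreeGroup.mk [(i, true)]) = x i := FreeGroup.lift_apply_of
      rw [this]
      rfl
    | false =>
      have : FreeGroup.lift x (FreeGroup.mk [(i, false)]) = (x i)⁻¹ := by
        change FreeGroup.lift x (FreeGroup.of i)⁻¹ = _
        rw [map_inv, FreeGroup.lift_apply_of]
      rw [this]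
      rfl

theorem definable_realize_term {L : FirstOrder.Language} {M : Type*} [L.Structure M] {A : Set M}
    (φ : L.Formula (A ⊕ Fin 1)) (t : L.Term ι) : A.Definable L
      {x : ι → M | φ.Realize (Sum.elim Subtype.val fun _ => t.realize x)} := by
  rw [Set.definable_iff_exists_formula_sum]
  refine ⟨Language.BoundedFormula.subst φ (Sum.elim (fun a => Language.Term.var (Sum.inl a))
    fun _ => t.relabel Sum.inr), ?_⟩
  ext x
  simp only [Set.mem_ofPred_eq, Language.Formula.Realize, Language.BoundedFormula.realize_subst]
  congr! 1
  funext a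
  rcases a with a | a <;> simp

/-- A homomorphism from a free group of finite rank can be approximated by homomorphisms confining
finitely many algebraic values, moving finitely many other values out of a finite set, and
preserving finitely many nontrivial values. -/
theorem exists_approximation [Finite ι] (A : Set G) (x₀ : ι → G) : ∃ Φ : FreeGroup ι → Set G,
    (∀ k, (Φ k).Finite) ∧ ∀ (S : Finset (FreeGroup ι)) (Q : Set G), Q.Finite →
      ∃ f : FreeGroup ι →* G, ∀ k ∈ S,
        (FreeGroup.lift x₀ k ∈ acl A → f k ∈ Φ k) ∧
        (FreeGroup.lift x₀ k ∉ acl A → f k ∉ Q) ∧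
        (FreeGroup.lift x₀ k ≠ 1 → f k ≠ 1) := by
  classical
  have h : ∀ k : FreeGroup ι, ∃ φ : grpLang.Formula (A ⊕ Fin 1), FreeGroup.lift x₀ k ∈ acl A →
      {c : G | φ.Realize (Sum.elim Subtype.val fun _ => c)}.Finite ∧
        φ.Realize (Sum.elim Subtype.val fun _ => FreeGroup.lift x₀ k) := by
    intro k
    by_cases hk : FreeGroup.lift x₀ k ∈ acl A
    · obtain ⟨φ, h1, h2⟩ := hk
      exact ⟨φ, fun _ => ⟨h1, h2⟩⟩
    · exact ⟨⊥, fun h1 => absurd h1 hk⟩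
  choose φ hφ using h
  refine ⟨fun k => if FreeGroup.lift x₀ k ∈ acl A then
    {c : G | (φ k).Realize (Sum.elim Subtype.val fun _ => c)} else ∅, fun k => ?_, ?_⟩
  · dsimp only
    split_ifs with hk
    · exact (hφ k hk).1
    · exact Set.finite_empty
  intro S Q hQ
  have hreal : ∀ (k : FreeGroup ι) (x : ι → G),
      (wordTerm k.toWord).realize x = FreeGroup.lift x k := fun k x => by
    rw [realize_wordTerm, FreeGroup.mk_toWord]
  let X : Set (ι → G) :=
    (⋂ k : {k : S // FreeGroup.lift x₀ k.1 ∈ acl A}, {x : ι → G | (φ k.1.1).Realize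
      (Sum.elim Subtype.val fun _ => (wordTerm k.1.1.toWord).realize x)}) ∩
    ⋂ k : {k : S // FreeGroup.lift x₀ k.1 ≠ 1}, {x : ι → G | (wordTerm k.1.1.toWord).realize x =
      (wordTerm []).realize x}ᶜ
  have hX : A.Definable grpLang X :=
    (Set.definable_iInter_of_finite fun k => definable_realize_term _ _).inter
      (Set.definable_iInter_of_finite fun k => (definable_term_eq _ _).compl)
  have hXmem : ∀ {x}, x ∈ X ↔ (∀ k ∈ S, FreeGroup.lift x₀ k ∈ acl A →
      (φ k).Realize (Sum.elim Subtype.val fun _ => FreeGroup.lift x k)) ∧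
      ∀ k ∈ S, FreeGroup.lift x₀ k ≠ 1 → FreeGroup.lift x k ≠ 1 := by
    intro x
    simp [X, hreal, realize_wordTerm, ← FreeGroup.one_eq_mk]
  have hx₀ : x₀ ∈ X := hXmem.2 ⟨fun k _ hk => (hφ k hk).2, fun k _ hk => hk⟩
  obtain ⟨x, hx, hxQ⟩ := exists_mem_forall_realize_notMem hX
    (fun k : {k : S // FreeGroup.lift x₀ k.1 ∉ acl A} => wordTerm k.1.1.toWord) hx₀
    (fun k => by rw [hreal]; exact k.2) hQ
  rw [hXmem] at hx
  refine ⟨FreeGroup.lift x, fun k hk => ⟨fun h1 => ?_, fun h1 => ?_, hx.2 k hk⟩⟩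
  · dsimp only
    rw [if_pos h1]
    exact hx.1 k hk h1
  · have := hxQ ⟨⟨k, hk⟩, h1⟩
    rwa [hreal] at this

end

section Assembly

/-- A finite set `T` whose generated subgroup contains the basis elements indexed by `s` has at
least as many elements as `s`. -/
theorem FreeGroupBasis.card_le_of_mem_closure {β F : Type*} [Group F] {K : Subgroup F}
    (b : FreeGroupBasis β K) {s : Finset β} {T : Finset F} (hTK : ∀ t ∈ T, t ∈ K)
    (hs : ∀ i ∈ s, (b i : F) ∈ Subgroup.closure (T : Set F)) : s.card ≤ T.card := by
  classical
  let φ : K →* Multiplicative (β →₀ ℚ) := b.lift fun i => Multiplicative.ofAdd (Finsupp.single i 1)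
  have hφ : ∀ i, φ (b i) = Multiplicative.ofAdd (Finsupp.single i 1) := fun i =>
    congrFun (b.lift.symm_apply_apply _) i
  let V : Finset (β →₀ ℚ) := T.attach.image fun t : T => (φ ⟨t, hTK t t.2⟩).toAdd
  have hspan : ∀ x ∈ Subgroup.closure (T : Set F), ∃ hx : x ∈ K,
      (φ ⟨x, hx⟩).toAdd ∈ Submodule.span ℚ (V : Set (β →₀ ℚ)) := by
    intro x hx
    induction hx using Subgroup.closure_induction with
    | mem x hx =>
      exact ⟨hTK x hx, Submodule.subset_span (Finset.mem_coe.2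
        (Finset.mem_image.2 ⟨(⟨x, hx⟩ : T), Finset.mem_attach _ _, rfl⟩))⟩
    | one => exact ⟨K.one_mem, by
        have : (⟨1, K.one_mem⟩ : K) = 1 := rfl
        rw [this, map_one]
        exact Submodule.zero_mem _⟩
    | mul x y _ _ hx hy =>
      obtain ⟨hx, hx'⟩ := hx
      obtain ⟨hy, hy'⟩ := hy
      refine ⟨K.mul_mem hx hy, ?_⟩
      have : (⟨x * y, K.mul_mem hx hy⟩ : K) = ⟨x, hx⟩ * ⟨y, hy⟩ := rfl
      rw [this, map_mul]
      exact Submodule.add_mem _ hx' hy'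
    | inv x _ hx =>
      obtain ⟨hx, hx'⟩ := hx
      refine ⟨K.inv_mem hx, ?_⟩
      have : (⟨x⁻¹, K.inv_mem hx⟩ : K) = ⟨x, hx⟩⁻¹ := rfl
      rw [this, map_inv]
      exact Submodule.neg_mem _ hx'
  have hli : LinearIndependent ℚ fun i : s => (Finsupp.single i.1 1 : β →₀ ℚ) :=
    (Finsupp.linearIndependent_single_one ℚ β).comp _ Subtype.val_injective
  have hmem : ∀ i : s, (Finsupp.single i.1 1 : β →₀ ℚ) ∈
      Submodule.span ℚ (V : Set (β →₀ ℚ)) := by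
    intro i
    obtain ⟨h1, h2⟩ := hspan _ (hs i i.2)
    rw [show (⟨(b i : F), h1⟩ : K) = b i from rfl, hφ] at h2
    exact h2
  have hcard := linearIndependent_le_span' (R := ℚ)
    (fun i : s => (Finsupp.single i.1 1 : β →₀ ℚ)) hli (V : Set (β →₀ ℚ)) (by
      rintro _ ⟨i, rfl⟩
      exact hmem i)
  rw [Cardinal.mk_fintype, Fintype.card_coe] at hcard
  have h2 : s.card ≤ V.card := by simpa using hcard
  exact h2.trans (Finset.card_image_le.trans T.card_attach.le)

theorem FreeGroupBasis.closure_range {β H : Type*} [Group H] (b : FreeGroupBasis β H) :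
    Subgroup.closure (Set.range b) = ⊤ := by
  have h : Set.range b = b.repr.symm '' Set.range FreeGroup.of := by
    rw [← Set.range_comp]
    rfl
  rw [h, ← MonoidHom.coe_coe, ← MonoidHom.map_closure, FreeGroup.closure_range_of,
    ← MonoidHom.range_eq_map, MonoidHom.range_eq_top]
  exact b.repr.symm.surjective

theorem FreeGroupBasis.closure_range_val {β F : Type*} [Group F] {K : Subgroup F}
    (b : FreeGroupBasis β K) : Subgroup.closure (Set.range fun i => (b i : F)) = K := by
  have h : (Set.range fun i => (b i : F)) = K.subtype '' Set.range b := by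
    rw [← Set.range_comp]
    rfl
  rw [h, ← MonoidHom.map_closure, b.closure_range, ← MonoidHom.range_eq_map, Subgroup.range_subtype]

theorem FreeGroup.finite_norm_le {α : Type*} [DecidableEq α] [Finite α] (R : ℕ) :
    {g : FreeGroup α | norm g ≤ R}.Finite :=
  (List.finite_length_le (α × Bool) R).preimage toWord_injective.injOn

/-- Finite subsets of the algebraic closure lie in subgroups generated by few algebraic
elements. -/
theorem exists_generators_acl {F : Type*} [Group F] {α : Type*} [DecidableEq α] [Finite α]
    (e : F ≃* FreeGroup α) (A : Set F) {ι : Type*} [Fintype ι] (x₀ : ι → F)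
    (hx₀ : Function.Injective (FreeGroup.lift x₀))
    (hA : acl A ⊆ Set.range (FreeGroup.lift x₀)) {s : Set F} (hs : s.Finite)
    (hsA : s ⊆ Subgroup.closure (acl A)) :
    ∃ T : Finset F, T.card ≤ Fintype.card ι ∧ (T : Set F) ⊆ acl A ∧
      s ⊆ Subgroup.closure (T : Set F) := by
  classical
  obtain ⟨Φ, hΦ, hf⟩ := exists_approximation A x₀
  let J := Finset (FreeGroup ι) × ℕ
  let U : Ultrafilter J := Ultrafilter.of atTop
  have hU : ∀ {p : J → Prop}, (∀ᶠ j in atTop, p j) → ∀ᶠ j in (U : Filter J), p j :=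
    fun h => Ultrafilter.of_le _ h
  have hball : ∀ R, (e ⁻¹' {g | FreeGroup.norm g ≤ R}).Finite := fun R =>
    (FreeGroup.finite_norm_le R).preimage e.injective.injOn
  choose f hf using fun j : J => hf j.1 _ (hball j.2)
  let f' : J → FreeGroup ι →* FreeGroup α := fun j => e.toMonoidHom.comp (f j)
  have hlarge : ∀ (k : FreeGroup ι) (R : ℕ), ∀ᶠ j in (U : Filter J), k ∈ j.1 ∧ R ≤ j.2 := by
    intro k R
    refine hU ((eventually_ge_atTop (({k}, R) : J)).mono fun j hj => ⟨?_, hj.2⟩)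
    exact hj.1 (Finset.mem_singleton_self k)
  have hne : ∀ k, k ≠ 1 → ∀ᶠ j in (U : Filter J), f' j k ≠ 1 := by
    intro k hk
    refine (hlarge k 0).mono fun j hj => ?_
    have h1 := (hf j k hj.1).2.2 fun h => hk (hx₀ (h.trans (map_one _).symm))
    exact fun h => h1 (e.injective (h.trans (map_one e).symm))
  have hbdd : ∀ k, FreeGroup.lift x₀ k ∈ acl A →
      ∃ R, ∀ᶠ j in (U : Filter J), FreeGroup.norm (f' j k) ≤ R := by
    intro k hk
    obtain ⟨R, hR⟩ := ((hΦ k).image fun x => FreeGroup.norm (e x)).bddAbove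
    exact ⟨R, (hlarge k 0).mono fun j hj =>
      hR (Set.mem_image_of_mem _ ((hf j k hj.1).1 hk))⟩
  have hacl : ∀ k, (∃ R, ∀ᶠ j in (U : Filter J), FreeGroup.norm (f' j k) ≤ R) →
      FreeGroup.lift x₀ k ∈ acl A := by
    rintro k ⟨R, hR⟩
    by_contra hk
    obtain ⟨j, hj, hj'⟩ := (hR.and (hlarge k R)).exists
    exact (hf j k hj'.1).2.1 hk (hj.trans hj'.2)
  have hclosure : ∀ x ∈ Subgroup.closure (acl A), ∃ k, FreeGroup.lift x₀ k = x ∧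
      ∃ R, ∀ᶠ j in (U : Filter J), FreeGroup.norm (f' j k) ≤ R := by
    intro x hx
    induction hx using Subgroup.closure_induction with
    | mem x hx =>
      obtain ⟨k, rfl⟩ := hA hx
      exact ⟨k, rfl, hbdd k hx⟩
    | one => exact ⟨1, map_one _, 0, Eventually.of_forall fun j => by simp⟩
    | mul x y _ _ hx hy =>
      obtain ⟨k, rfl, R, hR⟩ := hx
      obtain ⟨l, rfl, Q, hQ⟩ := hy
      refine ⟨k * l, map_mul _ _ _, R + Q, (hR.and hQ).mono fun j hj => ?_⟩
      rw [map_mul]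
      exact (FreeGroup.norm_mul_le _ _).trans (add_le_add hj.1 hj.2)
    | inv x _ hx =>
      obtain ⟨k, rfl, R, hR⟩ := hx
      refine ⟨k⁻¹, map_inv _ _, R, hR.mono fun j hj => ?_⟩
      rwa [map_inv, FreeGroup.norm_inv_eq]
  choose! w hw hwb using fun x hx => hclosure x (hsA hx)
  obtain ⟨N, hN⟩ := (hs.image fun x => (w x).toWord.length).bddAbove
  obtain ⟨T, hTcard, hTb, hT⟩ := FreeGroup.exists_generators_of_homs U f' hne N
  refine ⟨T.image (FreeGroup.lift x₀), Finset.card_image_le.trans hTcard, ?_, ?_⟩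
  · intro x hx
    obtain ⟨g, hg, rfl⟩ := Finset.mem_image.1 (Finset.mem_coe.1 hx)
    exact hacl g (hTb g hg)
  · intro x hx
    have h1 := hT (w x).toWord (hN (Set.mem_image_of_mem _ hx))
    rw [FreeGroup.mk_toWord] at h1
    have h2 := Subgroup.mem_map_of_mem (FreeGroup.lift x₀) (h1 (hwb x hx))
    rwa [MonoidHom.map_closure, hw x hx, ← Finset.coe_image] at h2

theorem srank_le_card {β F : Type*} [Group F] [Fintype β] {H : Subgroup F}
    (b : FreeGroupBasis β H) : srank H ≤ Fintype.card β := by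
  have hle : srank H ≤ Cardinal.mk (Set.range fun i => (b i : F)) :=
    csInf_le' ⟨_, b.closure_range_val, rfl⟩
  refine hle.trans ?_
  have := Cardinal.mk_range_le_lift (f := fun i => (b i : F))
  rw [Cardinal.mk_fintype β, Cardinal.lift_natCast] at this
  simpa using this

theorem card_le_srank {β F : Type*} [Group F] [Fintype β] {K : Subgroup F}
    (b : FreeGroupBasis β K) : (Fintype.card β : Cardinal) ≤ srank K := by
  refine le_csInf ⟨_, K, Subgroup.closure_eq K, rfl⟩ ?_
  rintro _ ⟨S, hS, rfl⟩
  by_cases hfin : S.Finite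
  · obtain ⟨T, rfl⟩ := hfin.exists_finset_coe
    have := b.card_le_of_mem_closure (s := Finset.univ) (T := T)
      (fun t ht => hS ▸ Subgroup.subset_closure ht) fun i _ => hS.symm ▸ (b i).2
    simpa using this
  · have : Infinite S := Set.infinite_coe_iff.2 hfin
    exact (Cardinal.natCast_lt_aleph0.le).trans (Cardinal.aleph0_le_mk S)

end Assembly

/-- Let `F` be a free group of finite rank and `A` a nonabelian
subgroup of `F`. Then `acl(A)` is compressed: for every finitely generated subgroup `K`
with `acl(A) ≤ K ≤ F`, one has `rk(acl(A)) ≤ rk(K)`. -/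
theorem acl_compressed {F : Type*} [Group F] (hF : IsFreeOfFiniteRank F)
    (A : Subgroup F) (hA : Nonabelian (A : Set F)) :
    ∀ K : Subgroup F, K.FG → acl (A : Set F) ⊆ (K : Set F) →
      srank (Subgroup.closure (acl (A : Set F))) ≤ srank K := by
  intro K hK hAK
  obtain ⟨n, ⟨e⟩⟩ := hF
  have hfree : IsFreeGroup F := (FreeGroupBasis.ofRepr e).isFreeGroup
  let b := IsFreeGroup.basis K
  obtain ⟨T, hT⟩ := hK
  let _ : Fintype (IsFreeGroup.Generators K) := fintypeOfFinsetCardLe T.card fun s =>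
    b.card_le_of_mem_closure (fun t ht => hT ▸ Subgroup.subset_closure ht)
      fun i _ => hT.symm ▸ (b i).2
  let x₀ : IsFreeGroup.Generators K → F := fun i => b i
  have hlift : FreeGroup.lift x₀ = K.subtype.comp b.repr.symm.toMonoidHom :=
    FreeGroup.ext_hom _ _ fun i => by
      rw [FreeGroup.lift_apply_of]
      rfl
  have hinj : Function.Injective (FreeGroup.lift x₀) := by
    rw [hlift]
    exact K.subtype_injective.comp b.repr.symm.injective
  have hrange : acl (A : Set F) ⊆ Set.range (FreeGroup.lift x₀) := fun x hx =>
    ⟨b.repr ⟨x, hAK hx⟩, by simp [hlift]⟩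
  let c := IsFreeGroup.basis (Subgroup.closure (acl (A : Set F)))
  have hcard : ∀ s : Finset (IsFreeGroup.Generators (Subgroup.closure (acl (A : Set F)))),
      s.card ≤ Fintype.card (IsFreeGroup.Generators K) := by
    intro s
    obtain ⟨T, hT, hTA, hsT⟩ := exists_generators_acl e (A : Set F) x₀ hinj hrange
      (s.finite_toSet.image fun i => (c i : F)) (by
        rintro _ ⟨i, -, rfl⟩
        exact (c i).2)
    exact (c.card_le_of_mem_closure (fun t ht => Subgroup.subset_closure (hTA ht))
      fun i hi => hsT ⟨i, hi, rfl⟩).trans hT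
  let _ := fintypeOfFinsetCardLe _ hcard
  exact (srank_le_card c).trans ((Nat.cast_le.2 (hcard Finset.univ)).trans (card_le_srank b))
end

section
/- Let G be a finitely generated equationally noetherian group with a fixed finite generating set S, and let A be a subgroup of G. For every finite subset C ⊆ G the following are equivalent: (1) C ⊆ acl^∃(A); (2) there exists a finite subset B(C) ⊆ G such that for every elementary extension G* of G and every L-embedding f : G* → G* fixing A pointwise, f(C) ⊆ B(C); (3) there exists r > 0 such that for every elementary extension G* of G, every L-embedding f : G* → G* fixing A pointwise, and every sequence (gₙ : f(G) → G) strongly converging to f(G), one has (gₙ ∘ f)(C) ⊆ B_r for all but finitely many n, where B_r is the ball of radius r about the identity in the word metric of G with respect to S. -/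
open FirstOrder Filter

universe u

section HomsAsEmbeddings

variable {H K : Type*} [Group H] [Group K]

/-- An injective group homomorphism, as an embedding of `grpLang`-structures. -/
def grpEmbedding (f : H →* K) (hf : Function.Injective f) : H ↪[grpLang] K where
  toFun := f
  inj' := hf
  map_fun' := by
    intro n c x
    cases c
    · exact map_one f
    · exact map_inv f (x 0)
    · exact map_mul f (x 0) (x 1)
  map_rel' := fun r _ => Empty.elim r

/-- An elementary group homomorphism, as an elementary embedding of `grpLang`-structures. -/
def grpElementaryEmbedding (e : H →* K) (he : ElementaryEmb e) : H ↪ₑ[grpLang] K where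
  toFun := e
  map_formula' := fun n φ v => he n φ v

theorem ElementaryEmb.injective {e : H →* K} (he : ElementaryEmb e) : Function.Injective e :=
  (grpElementaryEmbedding e he).injective

theorem ElementaryEmb.realize_formula {e : H →* K} (he : ElementaryEmb e) {α : Type*}
    (φ : grpLang.Formula α) (v : α → H) : (φ.Realize fun i => e (v i)) ↔ φ.Realize v :=
  (grpElementaryEmbedding e he).map_formula φ v

theorem ElementaryEmb.realize_boundedFormula {e : H →* K} (he : ElementaryEmb e) {α : Type*}
    {n : ℕ} (φ : grpLang.BoundedFormula α n) (v : α → H) (xs : Fin n → H) :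
    φ.Realize (e ∘ v) (e ∘ xs) ↔ φ.Realize v xs :=
  (grpElementaryEmbedding e he).map_boundedFormula φ v xs

theorem IsExistential.realize_of_injective {f : H →* K} (hf : Function.Injective f) {α : Type*}
    {φ : grpLang.Formula α} (hφ : IsExistential φ) {v : α → H} (hv : φ.Realize v) :
    φ.Realize fun i => f (v i) := by
  obtain ⟨n, ψ, hψ, rfl⟩ := hφ
  rw [Language.BoundedFormula.realize_exs] at hv ⊢
  obtain ⟨xs, hxs⟩ := hv
  exact ⟨f ∘ xs, (hψ.realize_embedding (f := grpEmbedding f hf)).2 hxs⟩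

end HomsAsEmbeddings

section Ultrapower

variable {ι : Type*} (U : Ultrafilter ι) (G : Type*) [Group G]

/-- The ultrapower of a group, as a group of germs, is the model-theoretic ultrapower. -/
def germEquivProduct :
    Germ (U : Filter ι) G ≃[grpLang] (U : Filter ι).Product (fun _ => G) where
  toEquiv := Equiv.refl _
  map_fun' := by
    intro n c x
    obtain ⟨y, rfl⟩ : ∃ y : Fin n → ι → G, x = fun i => (y i : Germ (U : Filter ι) G) :=
      ⟨fun i => (x i).out, funext fun i => (Quotient.out_eq (x i)).symm⟩
    refine Eq.trans ?_ (Language.Ultraproduct.funMap_cast c y).symm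
    cases c <;> rfl
  map_rel' := fun r _ => Empty.elim r

/-- The diagonal embedding of a group in its ultrapower. -/
def diagHom : G →* Germ (U : Filter ι) G where
  toFun x := (x : Germ (U : Filter ι) G)
  map_one' := rfl
  map_mul' _ _ := rfl

theorem elementaryEmb_diagHom : ElementaryEmb (diagHom U G) := by
  intro n φ v
  rw [← Language.StrongHomClass.realize_formula (germEquivProduct U G) φ]
  refine (Language.Ultraproduct.realize_formula_cast φ fun i (_ : ι) => v i).trans ?_
  exact eventually_const

variable {G} {H : Type*} [Group H]

/-- The homomorphism of ultrapowers induced by a homomorphism. -/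
def germMapHom (f : G →* H) : Germ (U : Filter ι) G →* Germ (U : Filter ι) H where
  toFun := Germ.map f
  map_one' := congrArg (fun x : H => (x : Germ (U : Filter ι) H)) (map_one f)
  map_mul' x y := Quotient.inductionOn₂' x y fun _ _ =>
    congrArg (fun z : ι → H => (z : Germ (U : Filter ι) H)) (funext fun _ => map_mul f _ _)

theorem germMapHom_injective {f : G →* H} (hf : Function.Injective f) :
    Function.Injective (germMapHom U f) := by
  rintro ⟨x⟩ ⟨y⟩ h
  refine Quotient.sound ?_
  exact (Quotient.exact h : (f ∘ x) =ᶠ[U] (f ∘ y)).mono fun i hi => hf hi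

end Ultrapower

section DirectLimits

variable {M : ℕ → Type u} [∀ n, Group (M n)] (d : ∀ i j, i ≤ j → M i →* M j)
  [DirectedSystem M (d · · ·)]

/-- The canonical homomorphism from a stage of a directed system of groups to its limit. -/
noncomputable def limitOf (i : ℕ) : M i →* DirectLimit M d where
  toFun x := ⟦⟨i, x⟩⟧
  map_one' := (DirectLimit.one_def i).symm
  map_mul' x y := (DirectLimit.mul_def i x y).symm

theorem limitOf_map {i j : ℕ} (h : i ≤ j) (x : M i) : limitOf d j (d i j h x) = limitOf d i x :=
  DirectLimit.mk_apply (f := d) i j x h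

theorem limitOf_comp_map {i j : ℕ} (h : i ≤ j) {β : Type*} (w : β → M i) :
    limitOf d j ∘ d i j h ∘ w = limitOf d i ∘ w :=
  funext fun b => limitOf_map d h (w b)

theorem exists_limitOf_eq (z : DirectLimit M d) : ∃ i x, limitOf d i x = z := by
  obtain ⟨i, x, rfl⟩ := DirectLimit.exists_eq_mk d z
  exact ⟨i, x, rfl⟩

theorem realize_limitOf (hd : ∀ i j h, ElementaryEmb (d i j h)) {α : Type*} {n : ℕ}
    (φ : grpLang.BoundedFormula α n) (i : ℕ) (v : α → M i) (xs : Fin n → M i) :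
    φ.Realize (limitOf d i ∘ v) (limitOf d i ∘ xs) ↔ φ.Realize v xs := by
  have hinj (i : ℕ) : Function.Injective (limitOf d i) :=
    DirectLimit.mk_injective d (fun i j h => (hd i j h).injective) i
  induction φ generalizing i with
  | falsum => rfl
  | equal t₁ t₂ =>
    exact (Language.BoundedFormula.IsAtomic.equal t₁ t₂).isQF.realize_embedding
      (f := grpEmbedding (limitOf d i) (hinj i))
  | rel r => exact Empty.elim r
  | imp φ ψ ihφ ihψ =>
    exact imp_congr (ihφ i v xs) (ihψ i v xs)
  | @all n φ ih =>
    simp only [Language.BoundedFormula.realize_all]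
    constructor
    · intro h a
      refine (ih i v (Fin.snoc xs a)).1 ?_
      rw [Fin.comp_snoc]
      exact h _
    · intro h z
      obtain ⟨j, y, rfl⟩ := exists_limitOf_eq d z
      have hi : i ≤ max i j := le_max_left i j
      have hj : j ≤ max i j := le_max_right i j
      have key := (ih _ _ _).2 ((((hd _ _ hi).realize_boundedFormula φ.all v xs).2 h) (d _ _ hj y))
      rwa [Fin.comp_snoc, limitOf_map, limitOf_comp_map, limitOf_comp_map] at key

theorem elementaryEmb_limitOf (hd : ∀ i j h, ElementaryEmb (d i j h)) (i : ℕ) :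
    ElementaryEmb (limitOf d i) := by
  intro n φ v
  rw [Language.Formula.Realize, Language.Formula.Realize, ← realize_limitOf d hd φ i v]
  exact iff_of_eq (congrArg _ (Subsingleton.elim _ _))

end DirectLimits

section UltrapowerTower

variable (U : Ultrafilter ℕ) (G : Type u) [Group G]

/-- The iterated ultrapowers of a group. -/
def ultraTower : ℕ → Type u
  | 0 => G
  | n + 1 => Germ (U : Filter ℕ) (ultraTower n)

instance ultraTowerGroup : ∀ n, Group (ultraTower U G n)
  | 0 => inferInstanceAs (Group G)
  | n + 1 =>
    letI := ultraTowerGroup n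
    inferInstanceAs (Group (Germ (U : Filter ℕ) (ultraTower U G n)))

/-- The diagonal embedding of each iterated ultrapower in the next one. -/
def towerDiag (n : ℕ) : ultraTower U G n →* ultraTower U G (n + 1) :=
  diagHom U (ultraTower U G n)

theorem elementaryEmb_towerDiag (n : ℕ) : ElementaryEmb (towerDiag U G n) :=
  elementaryEmb_diagHom U (ultraTower U G n)

/-- The composites of the diagonal embeddings between iterated ultrapowers. -/
def towerMap (i j : ℕ) (h : i ≤ j) : ultraTower U G i →* ultraTower U G j :=
  Nat.leRecOn h (fun {k} g => (towerDiag U G k).comp g) (MonoidHom.id _)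

theorem towerMap_self (i : ℕ) : towerMap U G i i le_rfl = MonoidHom.id _ :=
  Nat.leRecOn_self _

theorem towerMap_succ {i j : ℕ} (h : i ≤ j) :
    towerMap U G i (j + 1) (h.trans j.le_succ) = (towerDiag U G j).comp (towerMap U G i j h) :=
  Nat.leRecOn_succ h _

theorem elementaryEmb_towerMap (i j : ℕ) (h : i ≤ j) : ElementaryEmb (towerMap U G i j h) := by
  induction j, h using Nat.le_induction with
  | base =>
    rw [towerMap_self]
    exact fun n φ v => Iff.rfl
  | succ j h ih =>
    rw [towerMap_succ U G h]
    exact fun n φ v => (elementaryEmb_towerDiag U G j n φ _).trans (ih n φ v)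

instance directedSystem_towerMap : DirectedSystem (ultraTower U G) (towerMap U G · · ·) where
  map_self i x := DFunLike.congr_fun (towerMap_self U G i) x
  map_map k j i hij hjk x := by
    induction k, hjk using Nat.le_induction with
    | base => exact DFunLike.congr_fun (towerMap_self U G j) _
    | succ k hjk ih =>
      rw [towerMap_succ U G hjk, towerMap_succ U G (hij.trans hjk)]
      exact congrArg (towerDiag U G k) ih

variable {U G}

/-- The homomorphisms between consecutive iterated ultrapowers induced by a homomorphism from
a group to its ultrapower. -/
def towerShift (f : G →* Germ (U : Filter ℕ) G) :
    ∀ n, ultraTower U G n →* ultraTower U G (n + 1)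
  | 0 => f
  | n + 1 => germMapHom U (towerShift f n)

variable {f : G →* Germ (U : Filter ℕ) G}

theorem towerShift_injective (hf : Function.Injective f) (n : ℕ) :
    Function.Injective (towerShift f n) := by
  induction n with
  | zero => exact hf
  | succ n ih => exact germMapHom_injective U ih

theorem towerShift_towerMap (i j : ℕ) (h : i ≤ j) (x : ultraTower U G i) :
    towerMap U G (i + 1) (j + 1) (Nat.succ_le_succ h) (towerShift f i x) =
      towerShift f j (towerMap U G i j h x) := by
  induction j, h using Nat.le_induction with
  | base => rw [towerMap_self, towerMap_self]; rfl
  | succ j h ih =>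
    rw [towerMap_succ U G h, towerMap_succ U G (Nat.succ_le_succ h)]
    exact congrArg (towerDiag U G (j + 1)) ih

/-- A homomorphism from a group to its ultrapower induces an endomorphism of the limit of the
iterated ultrapowers. -/
noncomputable def limitShift (f : G →* Germ (U : Filter ℕ) G) :
    DirectLimit (ultraTower U G) (towerMap U G) →* DirectLimit (ultraTower U G) (towerMap U G) where
  toFun := DirectLimit.lift (towerMap U G)
    (fun i x => limitOf (towerMap U G) (i + 1) (towerShift f i x)) fun i j h x => by
      rw [← towerShift_towerMap i j h, limitOf_map]
  map_one' := by
    rw [DirectLimit.one_def (f := towerMap U G) 0, DirectLimit.lift_def, map_one, map_one,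
      ← DirectLimit.one_def (f := towerMap U G) 0]
  map_mul' x y := by
    refine DirectLimit.induction₂ _ (fun i x y => ?_) x y
    rw [DirectLimit.mul_def]
    simp only [DirectLimit.lift_def, map_mul]

theorem limitShift_injective (hf : Function.Injective f) : Function.Injective (limitShift f) := by
  refine DirectLimit.lift_injective (towerMap U G) _ ?_ fun i =>
    (elementaryEmb_limitOf _ (elementaryEmb_towerMap U G) (i + 1)).injective.comp
      (towerShift_injective hf i)
  intro i j h x
  simp only [Function.comp_apply]
  rw [← towerShift_towerMap i j h, limitOf_map]

/-- An embedding of a group in its ultrapower extends to an embedding of an elementary extension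
in itself. -/
theorem exists_elementaryEmb_of_ultrapower (hf : Function.Injective f) :
    ∃ (Gs : Type u) (_ : Group Gs) (e : G →* Gs) (F : Gs →* Gs), ElementaryEmb e ∧
      Function.Injective F ∧ ∀ x b, F (e x) = e b ↔ f x = diagHom U G b := by
  refine ⟨DirectLimit (ultraTower U G) (towerMap U G), inferInstance, limitOf (towerMap U G) 0,
    limitShift f, elementaryEmb_limitOf _ (elementaryEmb_towerMap U G) 0,
    limitShift_injective hf, fun x b => ?_⟩
  have hb : limitOf (towerMap U G) 0 b = limitOf (towerMap U G) 1 (diagHom U G b) := by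
    refine (limitOf_map (towerMap U G) zero_le_one b).symm.trans (congrArg _ ?_)
    refine (DFunLike.congr_fun (towerMap_succ U G (le_refl 0)) b).trans ?_
    exact congrArg (towerDiag U G 0) (DFunLike.congr_fun (towerMap_self U G 0) b)
  exact (iff_of_eq (congrArg _ hb)).trans
    (elementaryEmb_limitOf _ (elementaryEmb_towerMap U G) 1).injective.eq_iff

end UltrapowerTower

section BoundedImages

variable {G : Type u} [Group G]

/-- A formula with finitely many solutions in a group has no further solutions in an elementary
extension. -/
theorem ElementaryEmb.exists_eq_of_finite {Gs : Type u} [Group Gs] {e : G →* Gs}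
    (he : ElementaryEmb e) {α : Type*} (φ : grpLang.Formula (α ⊕ Fin 1)) (v : α → G)
    (hfin : {c : G | φ.Realize (Sum.elim v fun _ => c)}.Finite) {y : Gs}
    (hy : φ.Realize (Sum.elim (fun a => e (v a)) fun _ => y)) :
    ∃ b, φ.Realize (Sum.elim v fun _ => b) ∧ e b = y := by
  by_contra! hne
  let B : Set G := {c : G | φ.Realize (Sum.elim v fun _ => c)}
  have : Finite B := hfin
  let χ : grpLang.Formula ((α ⊕ B) ⊕ Fin 1) :=
    φ.relabel (Sum.map Sum.inl id) ⊓
      Language.Formula.iInf fun b : B =>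
        ∼((Language.Term.var (Sum.inr 0)).equal (Language.Term.var (Sum.inl (Sum.inr b))))
  have hχ {K : Type u} [Group K] (w : α → K) (u : B → K) (z : Fin 1 → K) :
      χ.Realize (Sum.elim (Sum.elim w u) z) ↔
        φ.Realize (Sum.elim w z) ∧ ∀ b : B, z 0 ≠ u b := by
    simp [χ, Language.Formula.realize_relabel, Sum.elim_comp_map, Language.Formula.realize_equal]
  have key := he.realize_formula (χ.iExs (Fin 1)) (Sum.elim v Subtype.val)
  have hcomp : (fun i => e (Sum.elim v (Subtype.val : B → G) i)) =
      Sum.elim (fun a => e (v a)) (fun b : B => e b) := by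
    ext (i | i) <;> rfl
  rw [hcomp] at key
  simp only [Language.Formula.realize_iExs] at key
  obtain ⟨z, hz⟩ := key.1 ⟨fun _ => y, (hχ _ _ _).2 ⟨hy, fun b => (hne b b.2).symm⟩⟩
  obtain ⟨hz₁, hz₂⟩ := (hχ _ _ _).1 hz
  have hz₀ : z = fun _ => z 0 := funext fun i => congrArg z (Subsingleton.elim i 0)
  rw [hz₀] at hz₁
  exact hz₂ ⟨z 0, hz₁⟩ rfl

/-- An existentially algebraic element has finitely many possible images under embeddings of
elementary extensions fixing the parameters. -/
theorem exists_finite_of_mem_aclE {A : Set G} {c : G} (hc : c ∈ aclE A) :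
    ∃ B : Set G, B.Finite ∧ ∀ (Gs : Type u) [Group Gs] (e : G →* Gs), ElementaryEmb e →
      ∀ f : Gs →* Gs, Function.Injective f → (∀ a ∈ A, f (e a) = e a) → f (e c) ∈ e '' B := by
  obtain ⟨φ, hφ, hfin, hreal⟩ := hc
  refine ⟨_, hfin, fun Gs _ e he f hf hfix => ?_⟩
  have h := hφ.realize_of_injective (f := f.comp e) (hf.comp he.injective) hreal
  have hcomp : (fun i => (f.comp e) (Sum.elim Subtype.val (fun _ : Fin 1 => c) i)) =
      Sum.elim (fun a : A => e a) fun _ => f (e c) := by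
    ext (i | i)
    · exact hfix i i.2
    · rfl
  rw [hcomp] at h
  exact he.exists_eq_of_finite φ _ hfin h

theorem wordBall_finite {S : Set G} (hS : S.Finite) (r : ℕ) : (wordBall S r).Finite := by
  induction r with
  | zero =>
    refine (Set.finite_singleton (1 : G)).subset ?_
    rintro g ⟨l, hl, -, rfl⟩
    rw [List.eq_nil_of_length_eq_zero (Nat.le_zero.1 hl)]
    rfl
  | succ r ih =>
    have hT : {x : G | x ∈ S ∨ x⁻¹ ∈ S}.Finite := hS.union (hS.preimage inv_injective.injOn)
    refine ((Set.finite_singleton (1 : G)).union (hT.image2 (· * ·) ih)).subset ?_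
    rintro g ⟨_ | ⟨x, l⟩, hl, hmem, rfl⟩
    · exact Or.inl rfl
    · exact Or.inr ⟨x, hmem x List.mem_cons_self, l.prod,
        ⟨l, Nat.le_of_succ_le_succ hl, fun y hy => hmem y (List.mem_cons_of_mem x hy), rfl⟩,
        List.prod_cons.symm⟩

theorem exists_mem_wordBall {S : Set G} (hS : Subgroup.closure S = ⊤) (g : G) :
    ∃ r, g ∈ wordBall S r := by
  have hg : g ∈ (Subgroup.closure S).toSubmonoid := hS ▸ Subgroup.mem_top g
  rw [Subgroup.closure_toSubmonoid] at hg
  obtain ⟨l, hl, rfl⟩ := Submonoid.exists_list_of_mem_closure hg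
  exact ⟨l.length, l, le_rfl, hl, rfl⟩

theorem wordBall_mono {S : Set G} {r s : ℕ} (h : r ≤ s) : wordBall S r ⊆ wordBall S s :=
  fun _ ⟨l, hl, hmem, hprod⟩ => ⟨l, hl.trans h, hmem, hprod⟩

theorem exists_subset_wordBall {S : Set G} (hS : Subgroup.closure S = ⊤) {B : Set G}
    (hB : B.Finite) : ∃ r, 0 < r ∧ B ⊆ wordBall S r := by
  choose ρ hρ using exists_mem_wordBall hS
  obtain ⟨m, hm⟩ := (hB.image ρ).bddAbove
  exact ⟨m + 1, m.succ_pos, fun b hb =>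
    wordBall_mono ((hm (Set.mem_image_of_mem ρ hb)).trans m.le_succ) (hρ b)⟩

end BoundedImages

section ExistentialAvoidance

theorem FirstOrder.Language.BoundedFormula.isQF_iInf {L : Language} {α β : Type*} [Finite β]
    {n : ℕ} {f : β → L.BoundedFormula α n} (hf : ∀ b, (f b).IsQF) :
    (Language.BoundedFormula.iInf f).IsQF := by
  rw [Language.BoundedFormula.iInf]
  generalize Finset.toList _ = l
  induction l with
  | nil => exact Language.BoundedFormula.IsQF.top
  | cons b l ih => exact (hf b).inf ih

variable {G : Type*} [Group G]

/-- Evaluation of words over a subgroup `A` in finitely many variables. -/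
def evalWord (A : Subgroup G) {n : ℕ} (y : Fin n → G) :
    Monoid.Coprod A (FreeGroup (Fin n)) →* G :=
  Monoid.Coprod.lift A.subtype (FreeGroup.lift y)

theorem exists_term_realize_eq_evalWord (A : Subgroup G) {n : ℕ}
    (w : Monoid.Coprod A (FreeGroup (Fin n))) :
    ∃ t : grpLang.Term (((A : Set G) ⊕ Fin 1) ⊕ Fin n), ∀ (x : Fin 1 → G) (y : Fin n → G),
      t.realize (Sum.elim (Sum.elim Subtype.val x) y) = evalWord A y w := by
  have mul {v w : Monoid.Coprod A (FreeGroup (Fin n))}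
      (hv : ∃ t : grpLang.Term (((A : Set G) ⊕ Fin 1) ⊕ Fin n), ∀ (x : Fin 1 → G) (y : Fin n → G),
        t.realize (Sum.elim (Sum.elim Subtype.val x) y) = evalWord A y v)
      (hw : ∃ t : grpLang.Term (((A : Set G) ⊕ Fin 1) ⊕ Fin n), ∀ (x : Fin 1 → G) (y : Fin n → G),
        t.realize (Sum.elim (Sum.elim Subtype.val x) y) = evalWord A y w) :
      ∃ t : grpLang.Term (((A : Set G) ⊕ Fin 1) ⊕ Fin n), ∀ (x : Fin 1 → G) (y : Fin n → G),
        t.realize (Sum.elim (Sum.elim Subtype.val x) y) = evalWord A y (v * w) := by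
    obtain ⟨t, ht⟩ := hv
    obtain ⟨t', ht'⟩ := hw
    refine ⟨.func (l := 2) GrpFunc.mul ![t, t'], fun x y => ?_⟩
    rw [map_mul, ← ht x y, ← ht' x y]
    rfl
  induction w using Monoid.Coprod.induction_on with
  | inl a => exact ⟨.var (.inl (.inl a)), fun x y =>
      (Monoid.Coprod.lift_apply_inl A.subtype (FreeGroup.lift y) a).symm⟩
  | inr w =>
    induction w using FreeGroup.induction_on with
    | C1 =>
      refine ⟨.func (l := 0) GrpFunc.one ![], fun x y => ?_⟩
      rw [map_one, map_one]
      rfl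
    | of i =>
      refine ⟨.var (.inr i), fun x y => ?_⟩
      rw [evalWord, Monoid.Coprod.lift_apply_inr, FreeGroup.lift_apply_of]
      rfl
    | inv_of i ih =>
      obtain ⟨t, ht⟩ := ih
      refine ⟨.func (l := 1) GrpFunc.inv ![t], fun x y => ?_⟩
      rw [map_inv, map_inv, ← ht x y]
      rfl
    | mul v w hv hw =>
      rw [map_mul]
      exact mul hv hw
  | mul v w hv hw => exact mul hv hw

/-- The set of values of a word on the solutions of finitely many equations and inequations is
existentially definable. -/
theorem exists_isExistential_realize_iff (A : Subgroup G) {n : ℕ}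
    {T T' : Set (Monoid.Coprod A (FreeGroup (Fin n)))} (hT : T.Finite) (hT' : T'.Finite)
    (w : Monoid.Coprod A (FreeGroup (Fin n))) :
    ∃ φ : grpLang.Formula ((A : Set G) ⊕ Fin 1), IsExistential φ ∧
      ∀ x : G, φ.Realize (Sum.elim Subtype.val fun _ => x) ↔ ∃ y : Fin n → G,
        (∀ v ∈ T, evalWord A y v = 1) ∧ (∀ v ∈ T', evalWord A y v ≠ 1) ∧ evalWord A y w = x := by
  choose t ht using exists_term_realize_eq_evalWord A (n := n)
  have : Finite T := hT
  have : Finite T' := hT'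
  let ψ : grpLang.BoundedFormula ((A : Set G) ⊕ Fin 1) n :=
    (Language.BoundedFormula.iInf fun v : T => (t v).bdEqual (t 1)) ⊓
      ((Language.BoundedFormula.iInf fun v : T' => ∼((t v).bdEqual (t 1))) ⊓
        (t w).bdEqual (.var (.inl (.inr 0))))
  have atom (t₁ t₂ : grpLang.Term (((A : Set G) ⊕ Fin 1) ⊕ Fin n)) : (t₁.bdEqual t₂).IsQF :=
    (Language.BoundedFormula.IsAtomic.equal t₁ t₂).isQF
  have hψ : ψ.IsQF :=
    (Language.BoundedFormula.isQF_iInf fun _ => atom _ _).inf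
      ((Language.BoundedFormula.isQF_iInf fun _ => (atom _ _).not).inf (atom _ _))
  refine ⟨ψ.exs, ⟨n, ψ, hψ, rfl⟩, fun x => ?_⟩
  rw [Language.BoundedFormula.realize_exs]
  simp [ψ, ht, map_one]

/-- In a finitely generated equationally noetherian group, an element outside the existential
algebraic closure of a subgroup can be moved off any finite set by an endomorphism fixing the
subgroup and killing none of finitely many prescribed nontrivial elements. -/
theorem exists_hom_of_notMem_aclE (hEN : EqNoetherian G) {S : Set G} (hSfin : S.Finite)
    (hSgen : Subgroup.closure S = ⊤) (A : Subgroup G) {c : G} (hc : c ∉ aclE (A : Set G))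
    {F B : Set G} (hF : F.Finite) (hB : B.Finite) :
    ∃ h : G →* G, (∀ a ∈ A, h a = a) ∧ (∀ x ∈ F, x ≠ 1 → h x ≠ 1) ∧ h c ∉ B := by
  obtain ⟨n, hn, s, hs⟩ : ∃ n, 0 < n ∧ ∃ s : Fin n → G, insert 1 S = Set.range s := by
    have := (hSfin.insert 1).fintype
    refine ⟨Fintype.card ↥(insert 1 S), Fintype.card_pos_iff.2 ⟨1, Set.mem_insert _ _⟩,
      fun i => (Fintype.equivFin ↥(insert 1 S)).symm i, ?_⟩
    exact Subtype.range_coe.symm.trans ((Equiv.surjective _).range_comp _).symm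
  have hsurj : Function.Surjective (evalWord A s) := by
    rw [← MonoidHom.range_eq_top, eq_top_iff, ← hSgen, Subgroup.closure_le]
    intro x hx
    obtain ⟨i, rfl⟩ : x ∈ Set.range s := hs ▸ Set.mem_insert_of_mem 1 hx
    refine ⟨Monoid.Coprod.inr (FreeGroup.of i), ?_⟩
    rw [evalWord, Monoid.Coprod.lift_apply_inr, FreeGroup.lift_apply_of]
  let inc : Monoid.Coprod A (FreeGroup (Fin n)) →* Monoid.Coprod G (FreeGroup (Fin n)) :=
    Monoid.Coprod.map A.subtype (MonoidHom.id _)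
  let ev (y : Fin n → G) : Monoid.Coprod G (FreeGroup (Fin n)) →* G :=
    Monoid.Coprod.lift (MonoidHom.id G) (FreeGroup.lift y)
  have hev (y : Fin n → G) (w) : ev y (inc w) = evalWord A y w := by
    refine DFunLike.congr_fun (f := (ev y).comp inc) (Monoid.Coprod.hom_ext ?_ ?_) w
    · ext a; simp [ev, inc, evalWord]
    · ext i; simp [ev, inc, evalWord]
  obtain ⟨S₀, hS₀, hS₀fin, hS₀iff⟩ := hEN n hn (inc '' (evalWord A s).ker)
  obtain ⟨T, hTker, hTfin, rfl⟩ : ∃ T ⊆ ((evalWord A s).ker : Set _), T.Finite ∧ inc '' T = S₀ :=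
    Set.exists_subset_image_finite_and (p := (· = S₀)).1 ⟨S₀, hS₀, hS₀fin, rfl⟩
  choose σ hσ using hsurj
  obtain ⟨φ, hφ, hreal⟩ := exists_isExistential_realize_iff A hTfin
    ((hF.sdiff (t := {1})).image σ) (σ c)
  have hinf : {x : G | φ.Realize (Sum.elim Subtype.val fun _ => x)}.Infinite := by
    refine fun hfin => hc ⟨φ, hφ, hfin, (hreal c).2 ⟨s, fun v hv => hTker hv, ?_, hσ c⟩⟩
    rintro _ ⟨x, hx, rfl⟩
    rw [hσ]
    exact hx.2
  obtain ⟨x, hx, hxB⟩ := hinf.exists_notMem_finite hB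
  obtain ⟨y, hyT, hyF, rfl⟩ := (hreal x).1 hx
  have hker : (evalWord A s).ker ≤ (evalWord A y).ker := by
    intro w hw
    have h := (hS₀iff (ev y) (Monoid.Coprod.lift_comp_inl _ _)).1
      (by rintro _ ⟨v, hv, rfl⟩; rw [hev]; exact hyT v hv)
    rw [MonoidHom.mem_ker, ← hev]
    exact h _ (Set.mem_image_of_mem inc hw)
  let h : G →* G := (evalWord A s).liftOfRightInverse σ hσ ⟨evalWord A y, hker⟩
  have hh (w) : h (evalWord A s w) = evalWord A y w :=
    MonoidHom.liftOfRightInverse_comp_apply _ _ _ ⟨evalWord A y, hker⟩ w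
  have hh' (x : G) : h x = evalWord A y (σ x) := by rw [← hh, hσ]
  refine ⟨h, fun a ha => ?_, fun x hx hx1 => ?_, ?_⟩
  · have := hh (Monoid.Coprod.inl ⟨a, ha⟩)
    rwa [evalWord, evalWord, Monoid.Coprod.lift_apply_inl, Monoid.Coprod.lift_apply_inl] at this
  · rw [hh']
    exact hyF _ ⟨x, ⟨hx, hx1⟩, rfl⟩
  · rwa [hh']

end ExistentialAvoidance

section ConvergingSequences

variable {G : Type u} [Group G]

/-- A sequence of homomorphisms out of a finitely generated group can be reindexed so that each
equation `h n x = b` is eventually decided. -/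
theorem exists_reindex_eventually_decided {S : Set G} (hSfin : S.Finite)
    (hSgen : Subgroup.closure S = ⊤) (h : ℕ → G →* G) :
    ∃ ν : ℕ → ℕ, (∀ k, k ≤ ν k) ∧
      ∀ x b, (∀ᶠ k in atTop, h (ν k) x = b) ∨ ∀ᶠ k in atTop, h (ν k) x ≠ b := by
  have step (k : ℕ) : ∃ n, k ≤ n ∧ ∀ x ∈ wordBall S k, ∀ b ∈ wordBall S k,
      (h n x = b ↔ ∀ᶠ m in (hyperfilter ℕ : Filter ℕ), h m x = b) := by
    have hk : ∀ᶠ n in (hyperfilter ℕ : Filter ℕ), k ≤ n :=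
      Nat.hyperfilter_le_atTop (eventually_ge_atTop k)
    refine (hk.and ?_).exists
    refine (eventually_all_finite (wordBall_finite hSfin k)).2 fun x _ =>
      (eventually_all_finite (wordBall_finite hSfin k)).2 fun b _ => ?_
    by_cases hxb : ∀ᶠ m in (hyperfilter ℕ : Filter ℕ), h m x = b
    · exact hxb.mono fun n hn => iff_of_true hn hxb
    · exact (Ultrafilter.eventually_not.2 hxb).mono fun n hn => iff_of_false hn hxb
  choose ν hν hdec using step
  refine ⟨ν, hν, fun x b => ?_⟩
  obtain ⟨r, hr⟩ := exists_mem_wordBall hSgen x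
  obtain ⟨s, hs⟩ := exists_mem_wordBall hSgen b
  have key : ∀ᶠ k in atTop, (h (ν k) x = b ↔ ∀ᶠ m in (hyperfilter ℕ : Filter ℕ), h m x = b) :=
    (eventually_ge_atTop (max r s)).mono fun k hk =>
      hdec k x (wordBall_mono ((le_max_left r s).trans hk) hr) b
        (wordBall_mono ((le_max_right r s).trans hk) hs)
  by_cases hxb : ∀ᶠ m in (hyperfilter ℕ : Filter ℕ), h m x = b
  · exact Or.inl (key.mono fun k hk => hk.2 hxb)
  · exact Or.inr (key.mono fun k hk hk' => hxb (hk.1 hk'))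

/-- An element outside the existential algebraic closure of `A` escapes every finite set along
some sequence of endomorphisms fixing `A` with trivial stable kernel. -/
theorem exists_seq_hom_of_notMem_aclE (hEN : EqNoetherian G) {S : Set G} (hSfin : S.Finite)
    (hSgen : Subgroup.closure S = ⊤) (A : Subgroup G) {c : G} (hc : c ∉ aclE (A : Set G)) :
    ∃ h : ℕ → G →* G, (∀ n, ∀ a ∈ A, h n a = a) ∧
      (∀ x, x ≠ 1 → ∀ᶠ n in atTop, h n x ≠ 1) ∧
      (∀ x b, (∀ᶠ n in atTop, h n x = b) ∨ ∀ᶠ n in atTop, h n x ≠ b) ∧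
      ∀ B : Set G, B.Finite → ∀ᶠ n in atTop, h n c ∉ B := by
  choose h hfix hne hesc using fun k => exists_hom_of_notMem_aclE hEN hSfin hSgen A hc
    (wordBall_finite hSfin k) (wordBall_finite hSfin k)
  obtain ⟨ν, hν, hdec⟩ := exists_reindex_eventually_decided hSfin hSgen h
  refine ⟨fun k => h (ν k), fun k => hfix (ν k), fun x hx => ?_, hdec, fun B hB => ?_⟩
  · obtain ⟨r, hr⟩ := exists_mem_wordBall hSgen x
    exact (eventually_ge_atTop r).mono fun k hk =>
      hne (ν k) x (wordBall_mono (hk.trans (hν k)) hr) hx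
  · obtain ⟨r, -, hr⟩ := exists_subset_wordBall hSgen hB
    exact (eventually_ge_atTop r).mono fun k hk hk' =>
      hesc (ν k) (wordBall_mono (hk.trans (hν k)) (hr hk'))

/-- A sequence of endomorphisms, as a homomorphism to the ultrapower. -/
noncomputable def seqGermHom (h : ℕ → G →* G) : G →* Germ (hyperfilter ℕ : Filter ℕ) G where
  toFun x := ((fun n => h n x : ℕ → G) : Germ (hyperfilter ℕ : Filter ℕ) G)
  map_one' := congrArg (fun z : ℕ → G => (z : Germ (hyperfilter ℕ : Filter ℕ) G))
    (funext fun n => map_one (h n))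
  map_mul' x y := congrArg (fun z : ℕ → G => (z : Germ (hyperfilter ℕ : Filter ℕ) G))
    (funext fun n => map_mul (h n) x y)

theorem seqGermHom_eq_diagHom_iff {h : ℕ → G →* G}
    (hdec : ∀ x b, (∀ᶠ n in atTop, h n x = b) ∨ ∀ᶠ n in atTop, h n x ≠ b) (x b : G) :
    seqGermHom h x = diagHom (hyperfilter ℕ) G b ↔ ∀ᶠ n in atTop, h n x = b := by
  have hiff : seqGermHom h x = diagHom (hyperfilter ℕ) G b ↔
      ∀ᶠ n in (hyperfilter ℕ : Filter ℕ), h n x = b := Germ.coe_eq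
  rw [hiff]
  refine ⟨fun hx => (hdec x b).resolve_right fun hx' => ?_, fun hx => Nat.hyperfilter_le_atTop hx⟩
  obtain ⟨n, hn, hn'⟩ := (hx.and (Nat.hyperfilter_le_atTop hx')).exists
  exact hn' hn

/-- An element outside the existential algebraic closure of `A` is moved out of the base group by
an embedding `f` of an elementary extension fixing `A`, and there is a sequence strongly converging
to the image of the base group along which the image of the element escapes every finite set. -/
theorem exists_stronglyConverges_of_notMem_aclE (hEN : EqNoetherian G) {S : Set G}
    (hSfin : S.Finite) (hSgen : Subgroup.closure S = ⊤) (A : Subgroup G) {c : G}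
    (hc : c ∉ aclE (A : Set G)) :
    ∃ (Gs : Type u) (_ : Group Gs) (e : G →* Gs) (f : Gs →* Gs), ElementaryEmb e ∧
      Function.Injective f ∧ (∀ a ∈ A, f (e a) = e a) ∧ (∀ b, f (e c) ≠ e b) ∧
      ∃ g : ℕ → (↥((MonoidHom.range e).map f) →* G),
        StronglyConverges e ((MonoidHom.range e).map f) g ∧
        ∀ B : Set G, B.Finite → ∀ᶠ n in atTop,
          g n ⟨f (e c), Subgroup.mem_map_of_mem f (MonoidHom.mem_range.mpr ⟨c, rfl⟩)⟩ ∉ B := by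
  obtain ⟨h, hfix, hne, hdec, hesc⟩ := exists_seq_hom_of_notMem_aclE hEN hSfin hSgen A hc
  have hinj : Function.Injective (seqGermHom h) := by
    refine (injective_iff_map_eq_one _).2 fun x hx => by_contra fun hx1 => ?_
    have hx' := (seqGermHom_eq_diagHom_iff hdec x 1).1 (hx.trans (map_one _).symm)
    obtain ⟨n, hn, hn'⟩ := (hx'.and (hne x hx1)).exists
    exact hn' hn
  obtain ⟨Gs, _, e, f, he, hf, hfe⟩ := exists_elementaryEmb_of_ultrapower hinj
  replace hfe (x b : G) : f (e x) = e b ↔ ∀ᶠ n in atTop, h n x = b :=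
    (hfe x b).trans (seqGermHom_eq_diagHom_iff hdec x b)
  let p : G →* ↥((MonoidHom.range e).map f) :=
    (f.comp e).codRestrict _ fun x =>
      Subgroup.mem_map_of_mem f (MonoidHom.mem_range.mpr ⟨x, rfl⟩)
  have hp : Function.Bijective p := by
    refine ⟨fun x y hxy => hf.comp he.injective (congrArg Subtype.val hxy), ?_⟩
    rintro ⟨_, _, ⟨x, rfl⟩, rfl⟩
    exact ⟨x, rfl⟩
  let P : G ≃* ↥((MonoidHom.range e).map f) := MulEquiv.ofBijective p hp
  have hP (x : G) : ((P x : ↥((MonoidHom.range e).map f)) : Gs) = f (e x) := rfl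
  refine ⟨Gs, inferInstance, e, f, he, hf, fun a ha => (hfe a a).2 (.of_forall fun n => hfix n a ha),
    fun b hb => ?_, fun n => (h n).comp P.symm.toMonoidHom, ⟨?_, ?_, ?_, ?_⟩, fun B hB => ?_⟩
  · obtain ⟨n, hn, hn'⟩ := (((hfe c b).1 hb).and (hesc {b} (Set.finite_singleton b))).exists
    exact hn' hn
  · intro k
    exact hdec (P.symm k) 1
  · intro k hk
    by_contra hk1
    obtain ⟨n, hn, hn'⟩ :=
      (hk.and (hne (P.symm k) (by simpa using hk1))).exists
    exact hn' hn
  · intro d b hd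
    obtain ⟨x, rfl⟩ := P.surjective d
    simpa using (hfe x b).1 hd
  · intro d b hd
    obtain ⟨x, rfl⟩ := P.surjective d
    rw [hP, hfe]
    refine (hdec x b).resolve_right fun hx => ?_
    simp only [MonoidHom.comp_apply, MulEquiv.toMonoidHom_eq_coe, MonoidHom.coe_coe,
      MulEquiv.symm_apply_apply] at hd
    exact hd hx
  · have hPc : P.symm ⟨f (e c), Subgroup.mem_map_of_mem f (MonoidHom.mem_range.mpr ⟨c, rfl⟩)⟩ = c :=
      P.symm_apply_eq.2 rfl
    refine (hesc B hB).mono fun n hn => ?_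
    simpa [hPc] using hn

end ConvergingSequences

/-- Let `G` be a finitely generated equationally noetherian group with
a fixed finite generating set `S`, and `A` a subgroup of `G`. For every finite subset
`C ⊆ G` the following are equivalent: (1) `C ⊆ acl^∃(A)`; (2) there is a finite
`B(C) ⊆ G` such that for every elementary extension `G*` of `G` and every embedding
`f : G* → G*` fixing `A` pointwise, `f(C) ⊆ B(C)`; (3) there is `r > 0` such that for
every elementary extension `G*` of `G`, every embedding `f : G* → G*` fixing `A`
pointwise, and every sequence `gₙ : f(G) → G` strongly converging to `f(G)`, one has
`(gₙ ∘ f)(C) ⊆ B_r` for all but finitely many `n`. -/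
theorem aclE_iff_bounded_iff_converging {G : Type u} [Group G]
    (hEN : EqNoetherian G) (S : Set G) (hSfin : S.Finite)
    (hSgen : Subgroup.closure S = ⊤)
    (A : Subgroup G) (C : Set G) (hCfin : C.Finite) :
    ((C ⊆ aclE (A : Set G)) ↔
      ∃ B : Set G, B.Finite ∧
        ∀ (Gs : Type u) [inst : Group Gs] (e : G →* Gs), ElementaryEmb e →
          ∀ f : Gs →* Gs, Function.Injective f → (∀ a ∈ A, f (e a) = e a) →
            ∀ c ∈ C, f (e c) ∈ e '' B) ∧
    ((C ⊆ aclE (A : Set G)) ↔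
      ∃ r : ℕ, 0 < r ∧
        ∀ (Gs : Type u) [inst : Group Gs] (e : G →* Gs), ElementaryEmb e →
          ∀ f : Gs →* Gs, Function.Injective f → (∀ a ∈ A, f (e a) = e a) →
            ∀ g : ℕ → (↥((MonoidHom.range e).map f) →* G),
              StronglyConverges e ((MonoidHom.range e).map f) g →
              ∀ c ∈ C, ∀ᶠ n in Filter.atTop,
                g n ⟨f (e c),
                  Subgroup.mem_map_of_mem f (MonoidHom.mem_range.mpr ⟨c, rfl⟩)⟩ ∈
                  wordBall S r) := by
  have forward (hC : C ⊆ aclE (A : Set G)) : ∃ B : Set G, B.Finite ∧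
      ∀ (Gs : Type u) [Group Gs] (e : G →* Gs), ElementaryEmb e →
        ∀ f : Gs →* Gs, Function.Injective f → (∀ a ∈ A, f (e a) = e a) →
          ∀ c ∈ C, f (e c) ∈ e '' B := by
    choose! B hBfin hB using fun c (hc : c ∈ C) => exists_finite_of_mem_aclE (hC hc)
    refine ⟨⋃ c ∈ C, B c, hCfin.biUnion hBfin, fun Gs _ e he f hf hfix c hc => ?_⟩
    exact Set.image_mono (Set.subset_biUnion_of_mem hc) (hB c hc Gs e he f hf hfix)
  refine ⟨⟨forward, ?_⟩, ⟨fun hC => ?_, ?_⟩⟩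
  · rintro ⟨B, -, hB⟩ c hc
    by_contra hcA
    obtain ⟨Gs, _, e, f, he, hf, hfix, hne, -⟩ :=
      exists_stronglyConverges_of_notMem_aclE hEN hSfin hSgen A hcA
    obtain ⟨b, -, hb⟩ := hB Gs e he f hf hfix c hc
    exact hne b hb.symm
  · obtain ⟨B, hBfin, hB⟩ := forward hC
    obtain ⟨r, hr, hBr⟩ := exists_subset_wordBall hSgen hBfin
    refine ⟨r, hr, fun Gs _ e he f hf hfix g hg c hc => ?_⟩
    obtain ⟨b, hb, hfb⟩ := hB Gs e he f hf hfix c hc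
    exact (hg.2.2.1 ⟨f (e c), _⟩ b hfb.symm).mono fun n hn => hn ▸ hBr hb
  · rintro ⟨r, -, hr⟩ c hc
    by_contra hcA
    obtain ⟨Gs, _, e, f, he, hf, hfix, -, g, hg, hgc⟩ :=
      exists_stronglyConverges_of_notMem_aclE hEN hSfin hSgen A hcA
    obtain ⟨n, hn, hn'⟩ :=
      ((hr Gs e he f hf hfix g hg c hc).and (hgc _ (wordBall_finite hSfin r))).exists
    exact hn' hn
end
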